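/- arXiv:2112.02703 — 8 statements merged into one kernel-verified Lean document; each statement's English description precedes it below -/
import Mathlib

section
/- Let k, m ≥ 1, let Y ∈ Mat_{k×(k+m)}(ℝ) have rank k and let Z ∈ Mat_{(m+1)×(k+m)}(ℝ) have rank m+1. For j ∈ {1,…,m+1} write D_j for the determinant of the (k+m)×(k+m) matrix whose rows are the k rows of Y followed by the rows Z_1,…,Z_{j−1},Z_{j+1},…,Z_{m+1} of Z (the j-th row omitted, the rest in order). If at least one D_j is nonzero, then the intersection of the row space of Y with the row space of Z is a one-dimensional subspace of ℝ^{k+m}, spanned by the vector Σ_{j=1}^{m+1} (−1)^{j−1} D_j Z_j. -/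
open scoped Classical

noncomputable section

/-- The row space of a matrix: the span of its rows. -/
def rowSpace {k n : ℕ} (A : Matrix (Fin k) (Fin n) ℝ) : Submodule ℝ (Fin n → ℝ) :=
  Submodule.span ℝ (Set.range fun r => A r)

section AlternatingDets

variable {K : Type*} [Field K] {k m : ℕ}

theorem Fin.append_comp_succAbove_natAdd {α : Type*} (y : Fin k → α) (z : Fin (m + 1) → α)
    (j : Fin (m + 1)) :
    (fun i : Fin (k + m) =>
      (Fin.append y z : Fin (k + (m + 1)) → α) ((Fin.natAdd k j).succAbove i)) =
      Fin.append y (fun t => z (j.succAbove t)) := by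
  funext i
  refine Fin.addCases (fun i => ?_) (fun i => ?_) i
  · have h : (Fin.natAdd k j).succAbove (Fin.castAdd m i) = Fin.castAdd (m + 1) i :=
      Fin.succAbove_of_castSucc_lt _ _ (by simp [Fin.lt_def]; omega)
    rw [Fin.append_left, h, Fin.append_left]
  · have h : (Fin.natAdd k j).succAbove (Fin.natAdd k i) = Fin.natAdd k (j.succAbove i) := by
      ext
      simp only [Fin.succAbove, Fin.lt_def, Fin.val_castSucc, Fin.val_natAdd]
      split_ifs <;> simp <;> omega
    rw [Fin.append_right, h, Fin.append_right]

/-- Appending to a matrix with one more row than columns the values of a linear functional on its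
rows gives a singular square matrix. -/
theorem Matrix.det_cons_dual_apply {n : ℕ} (r : Fin (n + 1) → Fin n → K)
    (φ : Module.Dual K (Fin n → K)) :
    (Matrix.of fun i => (Fin.cons (φ (r i)) (r i) : Fin (n + 1) → K)).det = 0 := by
  rw [← Matrix.exists_mulVec_eq_zero_iff]
  refine ⟨Fin.cons (-1) fun l => φ fun j => if l = j then 1 else 0, fun h => ?_, ?_⟩
  · simpa using congrFun h 0
  · funext i
    simp only [Matrix.mulVec, dotProduct, Fin.sum_univ_succ, Matrix.of_apply, Fin.cons_zero,
      Fin.cons_succ, Pi.zero_apply]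
    rw [φ.pi_apply_eq_sum_univ (r i)]
    simp

/-- Laplace expansion of the determinant in `Matrix.det_cons_dual_apply` along its first column,
for a functional vanishing on the rows `y`. -/
theorem sum_alternating_dets_mul_dual_eq_zero
    (y : Fin k → Fin (k + m) → K) (z : Fin (m + 1) → Fin (k + m) → K)
    (φ : Module.Dual K (Fin (k + m) → K)) (hφ : ∀ i, φ (y i) = 0) :
    ∑ j : Fin (m + 1), (-1 : K) ^ (j : ℕ) *
      (Matrix.of (Fin.append y fun t => z (j.succAbove t))).det * φ (z j) = 0 := by
  have h := Matrix.det_cons_dual_apply (n := k + m)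
    (Fin.append y z : Fin (k + (m + 1)) → Fin (k + m) → K) φ
  rw [Matrix.det_succ_column_zero] at h
  have h' := (Fin.sum_univ_add (a := k) (b := m + 1) _).symm.trans h
  have hsub (j : Fin (m + 1)) :
      (Matrix.of fun i : Fin (k + (m + 1)) => (Fin.cons (φ (Fin.append y z i)) (Fin.append y z i) :
        Fin (k + m + 1) → K)).submatrix (Fin.natAdd k j).succAbove Fin.succ =
      Matrix.of (Fin.append y fun t => z (j.succAbove t)) := by
    rw [← Fin.append_comp_succAbove_natAdd]
    rfl
  simp only [Matrix.of_apply, Fin.cons_zero, Fin.append_left, Fin.append_right, hφ, mul_zero,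
    zero_mul, Finset.sum_const_zero, zero_add, Fin.val_natAdd, pow_add] at h'
  refine (mul_eq_zero_iff_left (a := (-1 : K) ^ k) (by simp)).1 ?_
  rw [Finset.mul_sum, ← h']
  refine Finset.sum_congr rfl fun j _ => ?_
  calc
    _ = (-1) ^ k * (-1) ^ (j : ℕ) * φ (z j) *
        (Matrix.of (Fin.append y fun t => z (j.succAbove t))).det := by ring
    _ = _ := congrArg (_ * ·) (congrArg Matrix.det (hsub j)).symm

theorem sum_alternating_dets_mem_span
    (y : Fin k → Fin (k + m) → K) (z : Fin (m + 1) → Fin (k + m) → K) :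
    ∑ j : Fin (m + 1), ((-1 : K) ^ (j : ℕ) *
      (Matrix.of (Fin.append y fun t => z (j.succAbove t))).det) • z j ∈
      Submodule.span K (Set.range y) := by
  by_contra hv
  obtain ⟨φ, hφv, hφ⟩ := Submodule.exists_le_ker_of_notMem hv
  refine hφv ?_
  simpa [mul_assoc] using sum_alternating_dets_mul_dual_eq_zero y z φ
    fun i => hφ (Submodule.subset_span ⟨i, rfl⟩)

end AlternatingDets

theorem Matrix.linearIndependent_of_rank_eq {k n : ℕ} {A : Matrix (Fin k) (Fin n) ℝ}
    (hA : A.rank = k) : LinearIndependent ℝ (fun r => A r) := by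
  rw [linearIndependent_iff_card_eq_finrank_span, Fintype.card_fin]
  exact hA.symm.trans A.rank_eq_finrank_span_row

theorem finrank_rowSpace {k n : ℕ} (A : Matrix (Fin k) (Fin n) ℝ) :
    Module.finrank ℝ (rowSpace A) = A.rank :=
  A.rank_eq_finrank_span_row.symm

/-- Let `Y` be a real `k × (k+m)` matrix of rank `k` and `Z` a real
`(m+1) × (k+m)` matrix of rank `m+1`, with `k, m ≥ 1`.  For `j : Fin (m+1)` let `D j` be
the determinant of the `(k+m) × (k+m)` matrix whose rows are the rows of `Y` followed by
the rows of `Z` with the `j`-th one omitted (the rest in order).  If some `D j` is nonzero,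
then the intersection of the row spaces of `Y` and `Z` is the one-dimensional subspace of
`ℝ^(k+m)` spanned by the (nonzero) vector `∑ j, (-1)^j · D j • Z j`. -/
theorem rowspace_intersection_spanned_by_alternating_dets
    (k m : ℕ) (hk : 1 ≤ k) (hm : 1 ≤ m)
    (Y : Matrix (Fin k) (Fin (k + m)) ℝ) (Z : Matrix (Fin (m + 1)) (Fin (k + m)) ℝ)
    (hY : Y.rank = k) (hZ : Z.rank = m + 1)
    (D : Fin (m + 1) → ℝ)
    (hD : ∀ j : Fin (m + 1),
      D j = ((Matrix.fromRows Y (Matrix.of fun t : Fin m => Z (j.succAbove t))).submatrix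
        (⇑finSumFinEquiv.symm) id).det)
    (hne : ∃ j, D j ≠ 0) :
    rowSpace Y ⊓ rowSpace Z =
      Submodule.span ℝ {∑ j : Fin (m + 1), ((-1 : ℝ) ^ (j : ℕ) * D j) • Z j} ∧
      (∑ j : Fin (m + 1), ((-1 : ℝ) ^ (j : ℕ) * D j) • Z j) ≠ 0 := by
  have hD' (j : Fin (m + 1)) :
      D j = (Matrix.of (Fin.append (fun i => Y i) fun t => Z (j.succAbove t))).det := by
    rw [hD]
    congr 1
    ext i l
    refine Fin.addCases (fun i => ?_) (fun i => ?_) i <;> simp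
  have hZli := Matrix.linearIndependent_of_rank_eq hZ
  obtain ⟨j₀, hj₀⟩ := hne
  set v := ∑ j : Fin (m + 1), ((-1 : ℝ) ^ (j : ℕ) * D j) • Z j with hv
  have hv0 : v ≠ 0 := fun h =>
    hj₀ (by simpa using Fintype.linearIndependent_iff.1 hZli _ h j₀)
  refine ⟨?_, hv0⟩
  have hvY : v ∈ rowSpace Y := by
    simp only [hv, hD']
    exact sum_alternating_dets_mem_span Y Z
  have hvZ : v ∈ rowSpace Z :=
    Submodule.sum_mem _ fun j _ => Submodule.smul_mem _ _ (Submodule.subset_span ⟨j, rfl⟩)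
  have hsup : rowSpace Y ⊔ rowSpace Z = ⊤ := by
    have hli : LinearIndependent ℝ (Fin.append (fun i => Y i) fun t => Z (j₀.succAbove t)) :=
      Matrix.linearIndependent_rows_iff_isUnit.2
        ((Matrix.isUnit_iff_isUnit_det _).2 (isUnit_iff_ne_zero.2 (hD' j₀ ▸ hj₀)))
    rw [eq_top_iff, ← hli.span_eq_top_of_card_eq_finrank' (by simp), Submodule.span_le]
    rintro _ ⟨i, rfl⟩
    refine Fin.addCases (fun i => ?_) (fun i => ?_) i
    · rw [Fin.append_left]
      exact Submodule.mem_sup_left (Submodule.subset_span ⟨i, rfl⟩)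
    · rw [Fin.append_right]
      exact Submodule.mem_sup_right (Submodule.subset_span ⟨_, rfl⟩)
  have hdim := Submodule.finrank_sup_add_finrank_inf_eq (rowSpace Y) (rowSpace Z)
  rw [hsup, finrank_top, Module.finrank_fin_fun, finrank_rowSpace, finrank_rowSpace, hY, hZ] at hdim
  refine (Submodule.eq_of_le_of_finrank_eq ?_ ?_).symm
  · rw [Submodule.span_singleton_le_iff_mem]
    exact ⟨hvY, hvZ⟩
  · rw [finrank_span_singleton hv0]
    omega

end
end

section
/- Let k, m ≥ 0, n ≥ 1, let C ∈ Mat_{k×n}(ℝ), Z ∈ Mat_{n×(k+m)}(ℝ), and let I ⊆ {1,…,n} with |I| = m. Let ⟨CZ, Z_I⟩ denote the determinant of the (k+m)×(k+m) matrix whose rows are the k rows of CZ followed by the rows Z_i of Z for i ∈ I in increasing order. Then ⟨CZ, Z_I⟩ = Σ_J s(J,I)·det(C^J)·det(Z_{I∪J}), where the sum is over all k-element subsets J ⊆ {1,…,n}∖I, C^J is the k×k submatrix of C on the columns J (in increasing order), Z_{I∪J} is the (k+m)×(k+m) submatrix of Z on the rows I∪J (in increasing order), and s(J,I) = (−1)^{|{(i,j)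 ∈ I×J : i < j}|}. -/
open scoped Classical

noncomputable section

/-- A rectangular `n × r` matrix (with `r ≤ n`) is *positive* if all of its maximal
`r × r` minors (rows selected in increasing order) have positive determinant. -/
def IsPositiveMatrix {n r : ℕ} (Z : Matrix (Fin n) (Fin r) ℝ) : Prop :=
  ∀ f : Fin r → Fin n, StrictMono f → 0 < (Z.submatrix f id).det

/-- A `k × n` matrix is *totally nonnegative* if all of its `k × k` minors
(columns selected in increasing order) have nonnegative determinant. -/
def IsTotallyNonnegRect {k n : ℕ} (C : Matrix (Fin k) (Fin n) ℝ) : Prop :=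
  ∀ g : Fin k → Fin n, StrictMono g → 0 ≤ (C.submatrix id g).det

/-- The row of `Z` whose (1-based) marker is `p`, i.e. the row with index `p - 1`. -/
def markerRow {n r : ℕ} (Z : Matrix (Fin n) (Fin r) ℝ) (p : ℕ) : Fin r → ℝ :=
  if h : p - 1 < n then Z ⟨p - 1, h⟩ else 0

/-- The twistor coordinate `⟨Y a₁ a₂ a₃ a₄⟩`: the determinant of the `(k+4) × (k+4)` matrix
whose rows are the `k` rows of `Y` followed by the rows of `Z` with (1-based) markers
`a 0, a 1, a 2, a 3`. -/
def twistor {n k : ℕ} (Z : Matrix (Fin n) (Fin (k + 4)) ℝ)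
    (Y : Matrix (Fin k) (Fin (k + 4)) ℝ) (a : Fin 4 → ℕ) : ℝ :=
  ((Matrix.fromRows Y (Matrix.of fun t => markerRow Z (a t))).submatrix
    (⇑finSumFinEquiv.symm) id).det

/-- The minor of `A` on the set of rows `S` (taken in increasing order), using all columns;
defined to be `0` if `S` does not have the right cardinality. -/
def rowMinor {N r : ℕ} (A : Matrix (Fin N) (Fin r) ℝ) (S : Finset (Fin N)) : ℝ :=
  if h : S.card = r then (A.submatrix (fun t => (S.orderIsoOfFin h t).1) id).det else 0

/-- The minor of `C` on the set of columns `J` (taken in increasing order), using all rows;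
defined to be `0` if `J` does not have the right cardinality. -/
def colMinor {k N : ℕ} (C : Matrix (Fin k) (Fin N) ℝ) (J : Finset (Fin N)) : ℝ :=
  if h : J.card = k then (C.submatrix id (fun t => (J.orderIsoOfFin h t).1)).det else 0



/-- An injective family indexed by `Fin k` with image `s` is the increasing enumeration of `s`
precomposed with a permutation. -/
theorem Finset.exists_perm_eq_orderEmbOfFin_comp {α : Type*} [LinearOrder α] {k : ℕ}
    (s : Finset α) (hs : s.card = k) {g : Fin k → α} (hg : Function.Injective g)
    (hgs : ∀ i, g i ∈ s) : ∃ σ : Equiv.Perm (Fin k), g = s.orderEmbOfFin hs ∘ σ := by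
  have hinj : Function.Injective fun i => (s.orderIsoOfFin hs).symm ⟨g i, hgs i⟩ := fun i j h =>
    hg (by simpa using h)
  refine ⟨Equiv.ofBijective _ (Finite.injective_iff_bijective.1 hinj), funext fun i => ?_⟩
  simp [← Finset.coe_orderIsoOfFin_apply]

/-- **Cauchy–Binet for alternating maps**: expansion of an alternating map evaluated at linear
combinations of a finite family of vectors. -/
theorem AlternatingMap.map_sum_smul_eq_sum_det {R M N ι : Type*} [CommRing R] [AddCommGroup M]
    [Module R M] [AddCommGroup N] [Module R N] [Fintype ι] [LinearOrder ι] {k : ℕ}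
    (f : M [⋀^Fin k]→ₗ[R] N) (C : Matrix (Fin k) ι R) (z : ι → M) :
    f (fun a => ∑ j, C a j • z j) =
      ∑ J ∈ (Finset.powersetCard k (Finset.univ : Finset ι)).attach,
        (C.submatrix id (J.1.orderEmbOfFin (Finset.mem_powersetCard_univ.1 J.2))).det •
          f (z ∘ J.1.orderEmbOfFin (Finset.mem_powersetCard_univ.1 J.2)) := by
  have hterm (g : Fin k → ι) :
      f (fun a => C a (g a) • z (g a)) = (∏ a, C a (g a)) • f (z ∘ g) :=
    f.toMultilinearMap.map_smul_univ (fun a => C a (g a)) (z ∘ g)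
  have hexp : f (fun a => ∑ j, C a j • z j) =
      ∑ g : Fin k → ι, (∏ a, C a (g a)) • f (z ∘ g) :=
    (f.toMultilinearMap.map_sum fun a j => C a j • z j).trans
      (Finset.sum_congr rfl fun g _ => hterm g)
  rw [hexp]
  have hdet (J : {J // J ∈ Finset.powersetCard k (Finset.univ : Finset ι)}) :
      (C.submatrix id (J.1.orderEmbOfFin (Finset.mem_powersetCard_univ.1 J.2))).det •
          f (z ∘ J.1.orderEmbOfFin (Finset.mem_powersetCard_univ.1 J.2)) =
        ∑ σ : Equiv.Perm (Fin k),
          (∏ a, C a (J.1.orderEmbOfFin (Finset.mem_powersetCard_univ.1 J.2) (σ a))) •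
            f (z ∘ J.1.orderEmbOfFin (Finset.mem_powersetCard_univ.1 J.2) ∘ σ) := by
    rw [← Matrix.det_transpose, Matrix.det_apply, Finset.sum_smul]
    refine Finset.sum_congr rfl fun σ _ => ?_
    rw [← Function.comp_assoc, f.map_perm, smul_comm, smul_assoc]
    rfl
  simp_rw [hdet]
  rw [← Finset.sum_product']
  symm
  refine Finset.sum_of_injOn
    (fun p => p.1.1.orderEmbOfFin (Finset.mem_powersetCard_univ.1 p.1.2) ∘ p.2)
    ?_ (by simp) ?_ (fun _ _ => rfl)
  · rintro ⟨⟨J, hJ⟩, σ⟩ - ⟨⟨K, hK⟩, τ⟩ - h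
    have hJK : J = K := by
      have := congrArg Set.range h
      simpa [Set.range_comp] using this
    subst hJK
    have hστ : σ = τ := Equiv.ext fun i =>
      (J.orderEmbOfFin (Finset.mem_powersetCard_univ.1 hJ)).injective (congrFun h i)
    rw [hστ]
  · intro g _ hg
    rw [f.map_eq_zero_of_not_injective, smul_zero]
    intro hinj
    have hginj : Function.Injective g := hinj.of_comp
    have hcard : (Finset.univ.image g).card = k := by
      rw [Finset.card_image_of_injective _ hginj, Finset.card_fin]
    obtain ⟨σ, hσ⟩ := (Finset.univ.image g).exists_perm_eq_orderEmbOfFin_comp hcard hginj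
      fun i => Finset.mem_image_of_mem g (Finset.mem_univ i)
    exact hg ⟨⟨⟨_, Finset.mem_powersetCard_univ.2 hcard⟩, σ⟩, by simp, hσ.symm⟩

/-- Fixing the right-hand block of arguments of an alternating map gives an alternating map in the
left-hand block. -/
def AlternatingMap.fixRight {R M N ι κ : Type*} [CommRing R] [AddCommGroup M] [Module R M]
    [AddCommGroup N] [Module R N] (f : M [⋀^ι ⊕ κ]→ₗ[R] N) (w : κ → M) : M [⋀^ι]→ₗ[R] N where
  toFun v := f (Sum.elim v w)
  map_update_add' v i x y := by
    simp only [← Sum.update_elim_inl]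
    convert f.map_update_add (Sum.elim v w) (Sum.inl i) x y
  map_update_smul' v i c x := by
    simp only [← Sum.update_elim_inl]
    convert f.map_update_smul (Sum.elim v w) (Sum.inl i) c x
  map_eq_zero_of_eq' v i j h hij :=
    f.map_eq_zero_of_eq (Sum.elim v w) (i := Sum.inl i) (j := Sum.inl j) h (by simpa using hij)

/-- The sign of the permutation sorting the concatenation of two increasing sequences is
determined by the number of inversions between them. -/
theorem Equiv.Perm.sign_eq_neg_one_pow_of_append {α : Type*} [LinearOrder α] {k m : ℕ}
    {u : Fin k → α} {v : Fin m → α} (hu : StrictMono u) (hv : StrictMono v)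
    {e : Fin (k + m) ↪o α} {σ : Equiv.Perm (Fin (k + m))} (h : Fin.append u v = e ∘ σ) :
    (σ.sign : ℤ) =
      (-1) ^ (Finset.univ.filter fun p : Fin m × Fin k => v p.1 < u p.2).card := by
  have hlt (i j : Fin (k + m)) : σ i < σ j ↔ Fin.append u v i < Fin.append u v j := by
    rw [h]
    exact e.lt_iff_lt.symm
  have hne (i : Fin k) (j : Fin m) : u i ≠ v j := by
    have hinj : Function.Injective (Fin.append u v) := h ▸ e.injective.comp σ.injective
    exact (Fin.append_injective_iff.1 hinj).2.2 i j
  have hleft (i i' : Fin k) : (if i < i' then if u i < u i' then 1 else -1 else (1 : ℤ)) = 1 := by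
    simp +contextual [hu.lt_iff_lt]
  have hright (j j' : Fin m) : (if j < j' then if v j < v j' then 1 else -1 else (1 : ℤ)) = 1 := by
    simp +contextual [hv.lt_iff_lt]
  have hcross (i : Fin k) (j : Fin m) : Fin.castAdd m i < Fin.natAdd k j :=
    Fin.lt_def.2 (i.is_lt.trans_le (Nat.le_add_right k j))
  rw [Equiv.Perm.sign_eq_prod_prod_Ioi]
  simp only [← Finset.filter_lt_eq_Ioi, Finset.prod_filter, Fin.prod_univ_add, hlt,
    Units.coe_prod, Units.val_mul, apply_ite Units.val, Units.val_one, Units.val_neg,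
    Fin.append_left, Fin.append_right, (Fin.strictMono_castAdd m).lt_iff_lt,
    Fin.natAdd_lt_natAdd_iff,
    hleft, hright, hcross, (hcross _ _).not_gt, if_true, if_false, Finset.prod_const_one, one_mul,
    mul_one]
  rw [← Finset.prod_const, Finset.prod_filter, Fintype.prod_prod_type_right]
  refine Finset.prod_congr rfl fun i _ => Finset.prod_congr rfl fun j _ => ?_
  rcases (hne i j).lt_or_gt with hij | hij
  · simp [hij, hij.not_gt]
  · simp [hij, hij.not_gt]

/-- The determinant of a row selection given by concatenating the increasing enumerations of two
disjoint index sets. -/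
theorem Matrix.det_submatrix_append_orderEmbOfFin {R α : Type*} [CommRing R] [LinearOrder α]
    {k m : ℕ} (Z : Matrix α (Fin (k + m)) R) {I J S : Finset α} (hJ : J.card = k)
    (hI : I.card = m) (hJI : Disjoint J I) (hS : S.card = k + m) (hIJ : I ∪ J = S) :
    (Z.submatrix (Fin.append (J.orderEmbOfFin hJ) (I.orderEmbOfFin hI)) id).det =
      (-1) ^ ((I ×ˢ J).filter fun p => p.1 < p.2).card *
        (Z.submatrix (S.orderEmbOfFin hS) id).det := by
  have hinj : Function.Injective (Fin.append (J.orderEmbOfFin hJ) (I.orderEmbOfFin hI)) := by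
    rw [Fin.append_injective_iff]
    refine ⟨(J.orderEmbOfFin hJ).injective, (I.orderEmbOfFin hI).injective, fun i j h => ?_⟩
    exact Finset.disjoint_left.1 hJI (J.orderEmbOfFin_mem hJ i) (h ▸ I.orderEmbOfFin_mem hI j)
  obtain ⟨σ, hσ⟩ := S.exists_perm_eq_orderEmbOfFin_comp hS hinj fun i => by
    rw [← hIJ, Finset.mem_union]
    induction i using Fin.addCases <;> simp
  have hcard : ((I ×ˢ J).filter fun p => p.1 < p.2).card =
      (Finset.univ.filter fun p : Fin m × Fin k =>
        I.orderEmbOfFin hI p.1 < J.orderEmbOfFin hJ p.2).card := by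
    conv_lhs => rw [← I.map_orderEmbOfFin_univ hI, ← J.map_orderEmbOfFin_univ hJ,
      ← Finset.prodMap_map_product, Finset.filter_map, Finset.card_map]
    rfl
  rw [hσ, hcard]
  have hdet := (Z.submatrix (S.orderEmbOfFin hS) id).det_permute σ
  rw [Matrix.submatrix_submatrix, Equiv.Perm.sign_eq_neg_one_pow_of_append
    (J.orderEmbOfFin hJ).strictMono (I.orderEmbOfFin hI).strictMono hσ] at hdet
  simpa using hdet

/-- **Cauchy–Binet for twistor coordinates.**
For `C` a real `k × n` matrix, `Z` a real `n × (k+m)` matrix, and `I ⊆ Fin n` of size `m`,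
the determinant of the `(k+m) × (k+m)` matrix whose rows are the rows of `C * Z` followed by
the rows `Z_i`, `i ∈ I`, taken in increasing order, equals
`∑_J s(J,I) · det(C^J) · det(Z_{I ∪ J})`, the sum being over all `k`-element subsets
`J ⊆ Fin n` disjoint from `I`, with `s(J,I) = (-1)^{#{(i,j) ∈ I × J : i < j}}`. -/
theorem twistor_cauchy_binet
    (k m n : ℕ) (hn : 1 ≤ n)
    (C : Matrix (Fin k) (Fin n) ℝ) (Z : Matrix (Fin n) (Fin (k + m)) ℝ)
    (I : Finset (Fin n)) (hI : I.card = m) :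
    ((Matrix.fromRows (C * Z)
        (Matrix.of fun t : Fin m => Z (I.orderIsoOfFin hI t).1)).submatrix
        (⇑finSumFinEquiv.symm) id).det =
      ∑ J ∈ (Finset.univ : Finset (Fin n)).powersetCard k |>.filter (fun J => Disjoint J I),
        (-1 : ℝ) ^ ((I ×ˢ J).filter fun p => p.1 < p.2).card *
          colMinor C J * rowMinor Z (I ∪ J) := by
  let F : (Fin (k + m) → ℝ) [⋀^Fin k]→ₗ[ℝ] ℝ :=
    ((Matrix.detRowAlternating (n := Fin (k + m)) (R := ℝ)).domDomCongr
      finSumFinEquiv.symm).fixRight fun t => Z (I.orderEmbOfFin hI t)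
  have hFdet (v : Fin k → Fin (k + m) → ℝ) :
      F v = ((Matrix.fromRows (Matrix.of v)
        (Matrix.of fun t : Fin m => Z (I.orderEmbOfFin hI t))).submatrix
          finSumFinEquiv.symm id).det := by
    change Matrix.det _ = _
    congr 1
  have hFz (g : Fin k → Fin n) :
      F (fun a => Z (g a)) = (Z.submatrix (Fin.append g (I.orderEmbOfFin hI)) id).det := by
    rw [hFdet]
    congr 1
    ext i j
    induction i using Fin.addCases <;> simp
  have hCZ : C * Z = Matrix.of fun a => (∑ j, C a j • Z j : Fin (k + m) → ℝ) := by
    ext a b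
    simp [Matrix.mul_apply]
  simp only [Finset.coe_orderIsoOfFin_apply]
  rw [hCZ, ← hFdet, F.map_sum_smul_eq_sum_det C Z, Finset.sum_filter,
    ← Finset.sum_attach (Finset.powersetCard k Finset.univ)]
  refine Finset.sum_congr rfl fun J _ => ?_
  have hJ : J.1.card = k := Finset.mem_powersetCard_univ.1 J.2
  have hcol : colMinor C J.1 = (C.submatrix id (J.1.orderEmbOfFin hJ)).det := by
    simp [colMinor, hJ]
  rw [← hcol, smul_eq_mul]
  refine (congrArg (colMinor C J.1 * ·) (hFz _)).trans ?_
  split_ifs with hJI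
  · have hS : (I ∪ J.1).card = k + m := by
      rw [Finset.card_union_of_disjoint hJI.symm, hI, hJ, add_comm]
    have hrow : rowMinor Z (I ∪ J.1) = (Z.submatrix ((I ∪ J.1).orderEmbOfFin hS) id).det := by
      simp [rowMinor, hS]
    rw [Z.det_submatrix_append_orderEmbOfFin hJ hI hJI hS rfl, hrow]
    ring
  · obtain ⟨x, hxJ, hxI⟩ := Finset.not_disjoint_iff.1 hJI
    obtain ⟨a, ha⟩ : x ∈ Set.range (J.1.orderEmbOfFin hJ) := by simpa using hxJ
    obtain ⟨b, hb⟩ : x ∈ Set.range (I.orderEmbOfFin hI) := by simpa using hxI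
    rw [Matrix.det_zero_of_row_eq (i := Fin.castAdd m a) (j := Fin.natAdd k b), mul_zero]
    · simp [Fin.ext_iff]; omega
    · ext c
      simp [ha, hb]

end
end

section
/- Let k ≥ 1 and n ≥ k+4, let Z ∈ Mat_{n×(k+4)}(ℝ) be positive, and let C ∈ Mat_{k×n}(ℝ) be totally nonnegative of rank k. Then for all indices with 1 ≤ i < i+1 < j < j+1 ≤ n, the twistor ⟨(CZ) i i+1 j j+1⟩ is nonnegative, and it equals zero if and only if the row space of C contains a nonzero vector supported on the coordinates {i, i+1, j, j+1} (i.e., vanishing at all other coordinates). -/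
open scoped Classical

noncomputable section

open Matrix Equiv in
/-- Summing against an alternating map over a matrix product, symmetrized over the choice of
rows: `k! D(CZ) = ∑_f det(C_f) D(Z_f)`. -/
lemma AlternatingMap.factorial_mul_map_mul {k n m : ℕ} (D : (Fin m → ℝ) [⋀^Fin k]→ₗ[ℝ] ℝ)
    (C : Matrix (Fin k) (Fin n) ℝ) (Z : Matrix (Fin n) (Fin m) ℝ) :
    (k.factorial : ℝ) * D (C * Z) = ∑ f : Fin k → Fin n, (C.submatrix id f).det * D (Z ∘ f) := by
  have expand : D (C * Z) = ∑ f : Fin k → Fin n, (∏ r, C r (f r)) * D (Z ∘ f) := by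
    have hrows : C * Z = fun r => ∑ a, C r a • Z a := by
      ext r c
      simp [Matrix.mul_apply, Finset.sum_apply]
    rw [hrows]
    refine (D.toMultilinearMap.map_sum (fun r a => C r a • Z a)).trans ?_
    refine Finset.sum_congr rfl fun f _ => ?_
    exact D.toMultilinearMap.map_smul_univ (fun r => C r (f r)) fun r => Z (f r)
  have permuted (σ : Perm (Fin k)) : D (C * Z) =
      ∑ f : Fin k → Fin n, (Perm.sign σ : ℝ) * (∏ r, C r (f (σ r))) * D (Z ∘ f) := by
    rw [expand]
    refine (Fintype.sum_equiv (σ.arrowCongr (Equiv.refl (Fin n))) _ _ fun f => ?_)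
    have hf : Z ∘ f = (Z ∘ (σ.arrowCongr (Equiv.refl (Fin n)) f)) ∘ σ :=
      funext fun r => congrArg (Z ∘ f) (σ.symm_apply_apply r).symm
    rw [hf, D.map_perm]
    simp only [Equiv.arrowCongr_apply, Function.comp_apply, Equiv.symm_apply_apply,
      Equiv.refl_apply, Units.smul_def, zsmul_eq_mul]
    ring
  have hcard : (k.factorial : ℝ) * D (C * Z) = ∑ _σ : Perm (Fin k), D (C * Z) := by
    simp [Fintype.card_perm]
  rw [hcard, Finset.sum_congr rfl fun σ _ => permuted σ, Finset.sum_comm]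
  refine Finset.sum_congr rfl fun f _ => ?_
  rw [← Finset.sum_mul, ← det_transpose, det_apply']
  simp

lemma append_update_left {α : Type*} {k m : ℕ} [DecidableEq (Fin k)] [DecidableEq (Fin (k + m))]
    (u : Fin k → α) (w : Fin m → α) (r : Fin k) (x : α) :
    Fin.append (Function.update u r x) w =
      Function.update (Fin.append u w) (Fin.castAdd m r) x := by
  ext a : 1
  refine Fin.addCases (fun b => ?_) (fun b => ?_) a
  · by_cases hb : b = r <;> simp [hb]
  · have : Fin.natAdd k b ≠ Fin.castAdd m r := by
      simp [Fin.ext_iff]; omega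
    simp [this]

/-- The determinant as an alternating function of its first rows, the last rows being fixed. -/
def detAppend {k m : ℕ} (W : Fin m → Fin (k + m) → ℝ) :
    (Fin (k + m) → ℝ) [⋀^Fin k]→ₗ[ℝ] ℝ where
  toFun u := (Matrix.of (Fin.append u W)).det
  map_update_add' u r x y := by
    simp only [append_update_left]
    exact (Matrix.detRowAlternating (R := ℝ)).map_update_add (Fin.append u W) (Fin.castAdd m r) x y
  map_update_smul' u r c x := by
    simp only [append_update_left]
    exact (Matrix.detRowAlternating (R := ℝ)).map_update_smul (Fin.append u W) (Fin.castAdd m r) c x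
  map_eq_zero_of_eq' u r s hrs hne :=
    Matrix.det_zero_of_row_eq (i := Fin.castAdd m r) (j := Fin.castAdd m s)
      (by simpa [Fin.ext_iff] using hne) (by
        change Fin.append u W _ = Fin.append u W _
        simpa using hrs)

lemma detAppend_apply {k m : ℕ} (W : Fin m → Fin (k + m) → ℝ) (u : Fin k → Fin (k + m) → ℝ) :
    detAppend W u = (Matrix.of (Fin.append u W)).det := rfl

/-- The Vandermonde determinant is positive on strictly increasing nodes. -/
lemma det_vandermonde_pos {m : ℕ} {v : Fin m → ℝ} (hv : StrictMono v) :
    0 < (Matrix.vandermonde v).det := by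
  rw [Matrix.det_vandermonde]
  exact Finset.prod_pos fun a _ => Finset.prod_pos fun b hb =>
    sub_pos.2 (hv (Finset.mem_Ioi.1 hb))

lemma exists_perm_strictMono {m n : ℕ} {h : Fin m → Fin n} (hh : h.Injective) :
    ∃ σ : Equiv.Perm (Fin m), StrictMono (h ∘ σ) :=
  ⟨Tuple.sort h, (Tuple.monotone_sort h).strictMono_of_injective
    (hh.comp (Tuple.sort h).injective)⟩

lemma sign_mul_self_real {m : ℕ} (σ : Equiv.Perm (Fin m)) :
    ((Equiv.Perm.sign σ : ℤ) : ℝ) * ((Equiv.Perm.sign σ : ℤ) : ℝ) = 1 := by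
  rcases Int.units_eq_one_or (Equiv.Perm.sign σ) with h | h <;> simp [h]

/-- The minor of a positive matrix on arbitrary distinct rows has the sign of the corresponding
Vandermonde determinant. -/
lemma IsPositiveMatrix.det_mul_vandermonde_pos {n r : ℕ} {Z : Matrix (Fin n) (Fin r) ℝ}
    (hZ : IsPositiveMatrix Z) {h : Fin r → Fin n} (hh : h.Injective) :
    0 < (Z.submatrix h id).det * (Matrix.vandermonde fun a => ((h a : ℕ) : ℝ)).det := by
  obtain ⟨σ, hσ⟩ := exists_perm_strictMono hh
  have hpos := mul_pos (hZ _ hσ) (det_vandermonde_pos (v := fun a => ((h (σ a) : ℕ) : ℝ))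
    fun a b hab => Nat.cast_lt.2 (hσ hab))
  have e1 := Matrix.det_permute σ (Z.submatrix h id)
  have e2 := Matrix.det_permute σ (Matrix.vandermonde fun a => ((h a : ℕ) : ℝ))
  have e3 : (Matrix.vandermonde fun a => ((h a : ℕ) : ℝ)).submatrix σ id =
      Matrix.vandermonde fun a => ((h (σ a) : ℕ) : ℝ) := rfl
  rw [Matrix.submatrix_submatrix, Function.comp_id] at e1
  rw [e3] at e2
  rw [e1, e2] at hpos
  linear_combination (exp := 1) hpos + (Z.submatrix h id).det *
    (Matrix.vandermonde fun a => ((h a : ℕ) : ℝ)).det * sign_mul_self_real σ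

/-- The minor of a totally nonnegative matrix on arbitrary distinct columns has, weakly, the sign
of the corresponding Vandermonde determinant. -/
lemma IsTotallyNonnegRect.det_mul_vandermonde_nonneg {k n : ℕ} {C : Matrix (Fin k) (Fin n) ℝ}
    (hC : IsTotallyNonnegRect C) {h : Fin k → Fin n} (hh : h.Injective) :
    0 ≤ (C.submatrix id h).det * (Matrix.vandermonde fun a => ((h a : ℕ) : ℝ)).det := by
  obtain ⟨σ, hσ⟩ := exists_perm_strictMono hh
  have hpos := mul_nonneg (hC _ hσ) (det_vandermonde_pos (v := fun a => ((h (σ a) : ℕ) : ℝ))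
    fun a b hab => Nat.cast_lt.2 (hσ hab)).le
  have e1 := Matrix.det_permute' σ (C.submatrix id h)
  have e2 := Matrix.det_permute σ (Matrix.vandermonde fun a => ((h a : ℕ) : ℝ))
  have e3 : (Matrix.vandermonde fun a => ((h a : ℕ) : ℝ)).submatrix σ id =
      Matrix.vandermonde fun a => ((h (σ a) : ℕ) : ℝ) := rfl
  rw [Matrix.submatrix_submatrix, Function.comp_id] at e1
  rw [e3] at e2
  rw [e1, e2] at hpos
  linear_combination (exp := 1) hpos + (C.submatrix id h).det *
    (Matrix.vandermonde fun a => ((h a : ℕ) : ℝ)).det * sign_mul_self_real σ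

/-- Splitting the Vandermonde determinant of a concatenation of two lists of nodes. -/
lemma det_vandermonde_append {k m : ℕ} (u : Fin k → ℝ) (w : Fin m → ℝ) :
    (Matrix.vandermonde (Fin.append u w)).det =
      (Matrix.vandermonde u).det * (∏ a, ∏ b, (w b - u a)) * (Matrix.vandermonde w).det := by
  have ite_form {l : ℕ} (v : Fin l → ℝ) : (Matrix.vandermonde v).det =
      ∏ a, ∏ b, if a < b then v b - v a else 1 := by
    rw [Matrix.det_vandermonde]
    refine Finset.prod_congr rfl fun a _ => ?_
    rw [← Finset.prod_filter]
    congr 1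
    ext b
    simp
  simp only [ite_form, Fin.prod_univ_add, Fin.append_left, Fin.append_right]
  have h1 (a : Fin k) (b : Fin m) : Fin.castAdd m a < Fin.natAdd k b := by
    simp [Fin.lt_def]; omega
  have h2 (a : Fin m) (b : Fin k) : ¬ Fin.natAdd k a < Fin.castAdd m b := by
    simp [Fin.lt_def]; omega
  have h3 (a b : Fin k) : Fin.castAdd m a < Fin.castAdd m b ↔ a < b := Iff.rfl
  simp [h1, h2, h3, Finset.prod_mul_distrib]

/-- If every maximal minor of `C` on columns in `S` vanishes, then some nonzero combination of the
rows of `C` vanishes on `S`. -/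
lemma exists_vecMul_eq_zero_on {k n : ℕ} (C : Matrix (Fin k) (Fin n) ℝ) (S : Set (Fin n))
    (h : ∀ f : Fin k → Fin n, (∀ r, f r ∈ S) → (C.submatrix id f).det = 0) :
    ∃ c : Fin k → ℝ, c ≠ 0 ∧ ∀ a ∈ S, Matrix.vecMul c C a = 0 := by
  have hlt : Submodule.span ℝ (C.col '' S) < ⊤ := by
    rw [lt_top_iff_ne_top]
    intro htop
    obtain ⟨g, hgS, -, hg⟩ := Submodule.exists_fun_fin_finrank_span_eq ℝ (C.col '' S)
    have hk : Module.finrank ℝ (Submodule.span ℝ (C.col '' S)) = k := by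
      rw [htop, finrank_top, Module.finrank_fin_fun]
    choose f hfS hf using hgS
    have hdet := h (fun r => f (Fin.cast hk.symm r)) fun r => hfS _
    have hunit : IsUnit (C.submatrix id fun r => f (Fin.cast hk.symm r)) := by
      rw [← Matrix.linearIndependent_cols_iff_isUnit]
      have hcols : (C.submatrix id fun r => f (Fin.cast hk.symm r)).col = g ∘ Fin.cast hk.symm :=
        funext fun r => hf _
      rw [hcols]
      exact hg.comp (Fin.cast hk.symm) (Fin.cast_injective _)
    exact ((Matrix.isUnit_iff_isUnit_det _).1 hunit).ne_zero hdet
  obtain ⟨φ, hφ, hker⟩ := Submodule.exists_le_ker_of_lt_top _ hlt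
  have hφ_apply (x : Fin k → ℝ) : φ x = ∑ r, φ (Pi.single r 1) * x r := by
    conv_lhs => rw [pi_eq_sum_univ' x]
    simp [map_sum, mul_comm]
  refine ⟨fun r => φ (Pi.single r 1), fun h0 => hφ ?_, fun a ha => ?_⟩
  · ext r
    simpa using congrFun h0 r
  · have := hker (Submodule.subset_span ⟨a, ha, rfl⟩)
    rw [LinearMap.mem_ker, hφ_apply] at this
    exact this

lemma linearIndependent_row_of_rank_eq {k n : ℕ} {C : Matrix (Fin k) (Fin n) ℝ}
    (h : C.rank = k) : LinearIndependent ℝ C.row := by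
  rw [linearIndependent_iff_card_eq_finrank_span, Set.finrank, ← C.rank_eq_finrank_span_row, h,
    Fintype.card_fin]

lemma mem_rowSpace_iff {k n : ℕ} {C : Matrix (Fin k) (Fin n) ℝ} {v : Fin n → ℝ} :
    v ∈ rowSpace C ↔ ∃ c, Matrix.vecMul c C = v := by
  rw [rowSpace, Submodule.mem_span_range_iff_exists_fun]
  simp only [Matrix.vecMul_eq_sum]

/-- Products of differences with two adjacent integers are positive away from them. -/
lemma adjacent_sub_mul_pos {p x : ℕ} (h0 : x ≠ p) (h1 : x ≠ p + 1) :
    0 < ((p : ℝ) - x) * (((p + 1 : ℕ) : ℝ) - x) := by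
  rcases lt_or_gt_of_ne h0 with h | h
  · have : (x : ℝ) < p := by exact_mod_cast h
    push_cast
    exact mul_pos (by linarith) (by linarith)
  · have : ((p + 1 : ℕ) : ℝ) < x := by exact_mod_cast (by omega : p + 1 < x)
    push_cast at this ⊢
    exact mul_pos_of_neg_of_neg (by linarith) (by linarith)

/-- The increasing list of the (zero-based) rows `p, p+1, q, q+1`. -/
def boundaryRows {n p q : ℕ} (hpq : p + 1 < q) (hq : q + 1 < n) : Fin 4 → Fin n :=
  ![⟨p, by omega⟩, ⟨p + 1, by omega⟩, ⟨q, by omega⟩, ⟨q + 1, hq⟩]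

lemma boundaryRows_strictMono {n p q : ℕ} (hpq : p + 1 < q) (hq : q + 1 < n) :
    StrictMono (boundaryRows hpq hq) := by
  rw [Fin.strictMono_iff_lt_succ]
  intro a
  fin_cases a <;> simp [boundaryRows, Fin.lt_def]
  exact hpq

lemma detAppend_submatrix {k m n : ℕ} (Z : Matrix (Fin n) (Fin (k + m)) ℝ)
    (f : Fin k → Fin n) (w : Fin m → Fin n) :
    detAppend (Z ∘ w) (Z ∘ f) = (Z.submatrix (Fin.append f w) id).det := by
  rw [detAppend_apply]
  refine congrArg Matrix.det (funext fun a => ?_)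
  refine Fin.addCases (fun b => ?_) (fun b => ?_) a
  · exact (Fin.append_left _ _ b).trans (congrArg Z (Fin.append_left f w b).symm)
  · exact (Fin.append_right _ _ b).trans (congrArg Z (Fin.append_right f w b).symm)

lemma detAppend_eq_zero_of_not_injective {k m n : ℕ} (Z : Matrix (Fin n) (Fin (k + m)) ℝ)
    {f : Fin k → Fin n} {w : Fin m → Fin n} (h : ¬ (Fin.append f w).Injective) :
    detAppend (Z ∘ w) (Z ∘ f) = 0 := by
  rw [detAppend_submatrix]
  simp only [Function.Injective, not_forall] at h
  obtain ⟨a, b, hab, hne⟩ := h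
  exact Matrix.det_zero_of_row_eq hne (by
    ext c
    simp [hab])

/-- Moving two adjacent pairs past the rows `f` does not affect the sign of the minor. -/
lemma IsPositiveMatrix.detAppend_mul_vandermonde_pos {k n p q : ℕ}
    {Z : Matrix (Fin n) (Fin (k + 4)) ℝ} (hZ : IsPositiveMatrix Z) (hpq : p + 1 < q)
    (hq : q + 1 < n) {f : Fin k → Fin n}
    (hf : (Fin.append f (boundaryRows hpq hq)).Injective) :
    0 < detAppend (Z ∘ boundaryRows hpq hq) (Z ∘ f) *
      (Matrix.vandermonde fun a => ((f a : ℕ) : ℝ)).det := by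
  set w := boundaryRows hpq hq with hw
  have hpos := hZ.det_mul_vandermonde_pos hf
  have hsplit : (fun a => (((Fin.append f w a : Fin n) : ℕ) : ℝ)) =
      Fin.append (fun a => ((f a : ℕ) : ℝ)) fun b => ((w b : ℕ) : ℝ) := by
    ext a
    refine Fin.addCases (fun b => ?_) (fun b => ?_) a <;> simp
  rw [hsplit, det_vandermonde_append, ← detAppend_submatrix] at hpos
  have hvw : 0 < (Matrix.vandermonde fun b => ((w b : ℕ) : ℝ)).det :=
    det_vandermonde_pos fun a b hab => Nat.cast_lt.2 (boundaryRows_strictMono hpq hq hab)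
  have hcross : 0 < ∏ a : Fin k, ∏ b : Fin 4, (((w b : ℕ) : ℝ) - ((f a : ℕ) : ℝ)) := by
    refine Finset.prod_pos fun a _ => ?_
    have hne (b : Fin 4) : (f a : ℕ) ≠ w b := fun h => by
      have := @hf (Fin.castAdd 4 a) (Fin.natAdd k b) (by simpa [Fin.ext_iff] using h)
      simp [Fin.ext_iff] at this
      omega
    rw [Fin.prod_univ_four, mul_assoc]
    exact mul_pos (adjacent_sub_mul_pos (hne 0) (hne 1)) (adjacent_sub_mul_pos (hne 2) (hne 3))
  refine pos_of_mul_pos_left (b := (∏ a : Fin k, ∏ b : Fin 4,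
    (((w b : ℕ) : ℝ) - ((f a : ℕ) : ℝ))) * (Matrix.vandermonde fun b => ((w b : ℕ) : ℝ)).det)
    ?_ (mul_pos hcross hvw).le
  linarith

lemma markerRow_succ {n r : ℕ} (Z : Matrix (Fin n) (Fin r) ℝ) (a : Fin n) :
    markerRow Z (a + 1) = Z a := by
  simp [markerRow]

lemma twistor_eq_detAppend {k n p q : ℕ} (Z : Matrix (Fin n) (Fin (k + 4)) ℝ)
    (Y : Matrix (Fin k) (Fin (k + 4)) ℝ) (hpq : p + 1 < q) (hq : q + 1 < n) :
    twistor Z Y ![p + 1, p + 1 + 1, q + 1, q + 1 + 1] =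
      detAppend (Z ∘ boundaryRows hpq hq) Y := by
  refine Eq.trans ?_ (detAppend_apply _ Y).symm
  refine congrArg Matrix.det (funext fun a => ?_)
  change Matrix.fromRows Y _ (finSumFinEquiv.symm a) = _
  refine Fin.addCases (fun b => ?_) (fun b => ?_) a
  · rw [finSumFinEquiv_symm_apply_castAdd]
    exact (Fin.append_left (α := Fin (k + 4) → ℝ) Y _ b).symm
  · rw [finSumFinEquiv_symm_apply_natAdd]
    refine Eq.trans ?_ (Fin.append_right (α := Fin (k + 4) → ℝ) Y _ b).symm
    have hb : (![p + 1, p + 1 + 1, q + 1, q + 1 + 1] : Fin 4 → ℕ) b =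
        (boundaryRows hpq hq b : ℕ) + 1 := by
      fin_cases b <;> rfl
    exact (congrArg (markerRow Z) hb).trans (markerRow_succ Z _)

/-- Let `Z` be a positive `n × (k+4)` real matrix and `C` a totally
nonnegative `k × n` real matrix of rank `k`.  For all (1-based) indices
`1 ≤ i < i+1 < j < j+1 ≤ n`, the boundary twistor `⟨(CZ) i (i+1) j (j+1)⟩` is nonnegative,
and it vanishes iff the row space of `C` contains a nonzero vector supported on the
coordinates `{i, i+1, j, j+1}`. -/
theorem boundary_twistor_nonneg
    (k n : ℕ) (hk : 1 ≤ k) (hn : k + 4 ≤ n)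
    (Z : Matrix (Fin n) (Fin (k + 4)) ℝ) (hZ : IsPositiveMatrix Z)
    (C : Matrix (Fin k) (Fin n) ℝ) (hC : IsTotallyNonnegRect C) (hrank : C.rank = k)
    (i j : ℕ) (h1 : 1 ≤ i) (hij : i + 1 < j) (hjn : j + 1 ≤ n) :
    0 ≤ twistor Z (C * Z) ![i, i + 1, j, j + 1] ∧
      (twistor Z (C * Z) ![i, i + 1, j, j + 1] = 0 ↔
        ∃ v ∈ rowSpace C, v ≠ 0 ∧
          ∀ a : Fin n, (a : ℕ) + 1 ∉ ({i, i + 1, j, j + 1} : Finset ℕ) → v a = 0) := by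
  obtain ⟨p, rfl⟩ : ∃ p, i = p + 1 := ⟨i - 1, by omega⟩
  obtain ⟨q, rfl⟩ : ∃ q, j = q + 1 := ⟨j - 1, by omega⟩
  have hpq : p + 1 < q := by omega
  have hq : q + 1 < n := by omega
  rw [twistor_eq_detAppend Z _ hpq hq]
  set w := boundaryRows hpq hq with hw
  have hexp := (detAppend (Z ∘ w)).factorial_mul_map_mul C Z
  have hfact : (0 : ℝ) < k.factorial := by exact_mod_cast k.factorial_pos
  have hterm (f : Fin k → Fin n) : 0 ≤ (C.submatrix id f).det * detAppend (Z ∘ w) (Z ∘ f) := by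
    by_cases hf : (Fin.append f w).Injective
    · have hD := hZ.detAppend_mul_vandermonde_pos hpq hq hf
      have hCf := hC.det_mul_vandermonde_nonneg (Fin.append_injective_iff.1 hf).1
      have hv := right_ne_zero_of_mul hD.ne'
      refine nonneg_of_mul_nonneg_left (b := (Matrix.vandermonde fun a => ((f a : ℕ) : ℝ)).det ^ 2)
        ?_ (by positivity)
      linear_combination (exp := 1) mul_nonneg hCf hD.le
    · rw [detAppend_eq_zero_of_not_injective Z hf, mul_zero]
  have hnonneg : 0 ≤ detAppend (Z ∘ w) (C * Z) :=
    nonneg_of_mul_nonneg_right (hexp ▸ Finset.sum_nonneg fun f _ => hterm f) hfact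
  have hzero : detAppend (Z ∘ w) (C * Z) = 0 ↔
      ∀ f : Fin k → Fin n, (∀ r, f r ∉ Set.range w) → (C.submatrix id f).det = 0 := by
    have hsum : detAppend (Z ∘ w) (C * Z) = 0 ↔
        ∀ f : Fin k → Fin n, (C.submatrix id f).det * detAppend (Z ∘ w) (Z ∘ f) = 0 := by
      rw [← mul_right_inj' hfact.ne', mul_zero, hexp,
        Finset.sum_eq_zero_iff_of_nonneg fun f _ => hterm f]
      simp
    rw [hsum]
    refine forall_congr' fun f => ⟨fun h hf => ?_, fun h => ?_⟩
    · by_cases hinj : f.Injective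
      · have happ : (Fin.append f w).Injective := Fin.append_injective_iff.2
          ⟨hinj, (boundaryRows_strictMono hpq hq).injective, fun r b hrb => hf r ⟨b, hrb.symm⟩⟩
        exact (mul_eq_zero.1 h).resolve_right
          (left_ne_zero_of_mul (hZ.detAppend_mul_vandermonde_pos hpq hq happ).ne')
      · simp only [Function.Injective, not_forall] at hinj
        obtain ⟨a, b, hab, hne⟩ := hinj
        exact Matrix.det_zero_of_column_eq hne fun r => by simp [hab]
    · by_cases hf : ∀ r, f r ∉ Set.range w
      · rw [h hf, zero_mul]
      · push Not at hf
        obtain ⟨r, b, hb⟩ := hf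
        rw [detAppend_eq_zero_of_not_injective Z, mul_zero]
        exact fun happ => (Fin.append_injective_iff.1 happ).2.2 r b hb.symm
  have hsupp (a : Fin n) : (a : ℕ) + 1 ∉
      ({p + 1, p + 1 + 1, q + 1, q + 1 + 1} : Finset ℕ) ↔ a ∉ Set.range w := by
    simp [hw, boundaryRows, Fin.ext_iff]
    tauto
  refine ⟨hnonneg, hzero.trans ⟨fun h => ?_, ?_⟩⟩
  · obtain ⟨c, hc, hcS⟩ := exists_vecMul_eq_zero_on C (Set.range w)ᶜ h
    refine ⟨_, mem_rowSpace_iff.2 ⟨c, rfl⟩, fun h0 => hc ?_, fun a ha => hcS a ((hsupp a).1 ha)⟩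
    exact Matrix.vecMul_injective_iff.2 (linearIndependent_row_of_rank_eq hrank)
      (h0.trans (Matrix.zero_vecMul C).symm)
  · rintro ⟨v, hv, hv0, hvS⟩ f hf
    obtain ⟨c, rfl⟩ := mem_rowSpace_iff.1 hv
    refine Matrix.exists_vecMul_eq_zero_iff.1 ⟨c, fun hc => hv0 (by simp [hc]), ?_⟩
    ext r
    exact hvS (f r) ((hsupp _).2 (hf r))

end
end

section
/- Let k ≥ 1 and n ≥ k+4, let Z ∈ Mat_{n×(k+4)}(ℝ) be positive, and let C ∈ Mat_{k×n}(ℝ) be totally nonnegative of rank k. Then for all indices i with 2 ≤ i and i+1 ≤ n−1, the quantity (−1)^k·⟨(CZ) 1 i i+1 n⟩ is nonnegative, and it equals zero if and only if the row space of C contains a nonzero vector supported on the coordinates {1, i, i+1, n}. -/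
open scoped Classical

noncomputable section

/-- A matrix all of whose maximal column minors vanish has linearly dependent rows. -/
theorem exists_vecMul_eq_zero_of_forall_minor_eq_zero {k : ℕ} {ι : Type*} [Fintype ι]
    (A : Matrix (Fin k) ι ℝ) (h : ∀ f : Fin k → ι, (A.submatrix id f).det = 0) :
    ∃ w ≠ 0, Matrix.vecMul w A = 0 := by
  by_contra! hw
  have hli : LinearIndependent ℝ A.row := by
    rw [← Matrix.vecMul_injective_iff, ← Matrix.coe_vecMulLinear,
      injective_iff_map_eq_zero]
    intro w hw0
    by_contra hne
    exact hw w hne hw0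
  have hfin : Module.finrank ℝ (Submodule.span ℝ (Set.range A.col)) = k := by
    rw [← Matrix.rank_eq_finrank_span_cols, hli.rank_matrix, Fintype.card_fin]
  have hex := Submodule.exists_fun_fin_finrank_span_eq ℝ (Set.range A.col)
  rw [hfin] at hex
  obtain ⟨v, hv, -, hvli⟩ := hex
  choose f hf using hv
  have hcol : v = (A.submatrix id f).col := by
    funext a
    exact (hf a).symm
  rw [hcol, Matrix.linearIndependent_cols_iff_isUnit, Matrix.isUnit_iff_isUnit_det, h f] at hvli
  simp at hvli

/-- Maximal minors of a positive matrix along an injective list of rows have the sign given by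
the parity of the number of inversions of the list. -/
theorem IsPositiveMatrix.prod_inversions_mul_det_pos {n r : ℕ} {Z : Matrix (Fin n) (Fin r) ℝ}
    (hZ : IsPositiveMatrix Z) {h : Fin r → Fin n} (hh : Function.Injective h) :
    0 < (∏ y, ∏ x ∈ Finset.Iio y, if h x < h y then (1 : ℝ) else -1) *
      (Z.submatrix h id).det := by
  set s := Tuple.sort h with hs
  have hmono : StrictMono (h ∘ s) :=
    (Tuple.monotone_sort h).strictMono_of_injective (hh.comp s.injective)
  have hlt (x y : Fin r) : h x < h y ↔ s⁻¹ x < s⁻¹ y := by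
    have := hmono.lt_iff_lt (a := s⁻¹ x) (b := s⁻¹ y)
    simpa using this
  have hprod : (∏ y, ∏ x ∈ Finset.Iio y, if h x < h y then (1 : ℝ) else -1) =
      ((Equiv.Perm.sign s⁻¹ : ℤ) : ℝ) := by
    rw [Equiv.Perm.sign_eq_prod_prod_Iio]
    push_cast
    refine Finset.prod_congr rfl fun y _ => Finset.prod_congr rfl fun x _ => ?_
    simp only [hlt]
    split_ifs <;> simp
  have hdet : (Z.submatrix h id).det =
      ((Equiv.Perm.sign s⁻¹ : ℤ) : ℝ) * (Z.submatrix (h ∘ s) id).det := by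
    rw [← Matrix.det_permute]
    congr 1
    ext a b
    simp
  rw [hprod, hdet, ← mul_assoc, ← Int.cast_mul, Int.units_coe_mul_self, Int.cast_one, one_mul]
  exact hZ _ hmono

/-- If two lists are increasing and each entry of the first has an odd number of entries of the
second below it, then appending them gives a list of inversion sign `(-1) ^ k`. -/
theorem prod_inversions_append {n k m : ℕ} {g : Fin k → Fin n} {q : Fin m → Fin n}
    (hg : StrictMono g) (hq : StrictMono q)
    (hgq : ∀ a, ∏ t, (if g a < q t then (1 : ℝ) else -1) = -1) :
    (∏ y, ∏ x ∈ Finset.Iio y, if Fin.append g q x < Fin.append g q y then (1 : ℝ) else -1) =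
      (-1) ^ k := by
  have hIio (y : Fin (k + m)) :
      (∏ x ∈ Finset.Iio y, if Fin.append g q x < Fin.append g q y then (1 : ℝ) else -1) =
      ∏ x, if x < y then (if Fin.append g q x < Fin.append g q y then (1 : ℝ) else -1)
        else 1 := by
    rw [← Finset.prod_filter]
    congr 1
    ext x
    simp
  simp only [hIio, Fin.prod_univ_add, Fin.append_left, Fin.append_right]
  have h1 (y x : Fin k) : (if Fin.castAdd m x < Fin.castAdd m y then
      (if g x < g y then (1 : ℝ) else -1) else 1) = 1 := by
    split_ifs with h₁ h₂
    · rfl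
    · exact absurd (hg h₁) h₂
    · rfl
  have h2 (y : Fin k) (x : Fin m) : (if Fin.natAdd k x < Fin.castAdd m y then
      (if q x < g y then (1 : ℝ) else -1) else 1) = 1 := by
    rw [if_neg]
    simp only [Fin.lt_def, Fin.val_natAdd, Fin.val_castAdd]
    omega
  have h3 (y : Fin m) (x : Fin k) : (if Fin.castAdd m x < Fin.natAdd k y then
      (if g x < q y then (1 : ℝ) else -1) else 1) = if g x < q y then (1 : ℝ) else -1 := by
    rw [if_pos]
    simp only [Fin.lt_def, Fin.val_natAdd, Fin.val_castAdd]
    omega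
  have h4 (y x : Fin m) : (if Fin.natAdd k x < Fin.natAdd k y then
      (if q x < q y then (1 : ℝ) else -1) else 1) = 1 := by
    split_ifs with h₁ h₂
    · rfl
    · exact absurd (hq (by simpa using h₁)) h₂
    · rfl
  simp only [h1, h2, h3, h4, Finset.prod_const_one, mul_one, one_mul]
  rw [Finset.prod_comm]
  simp [hgq]

theorem fromRows_update_submatrix {k m : ℕ} (B : Matrix (Fin m) (Fin (k + m)) ℝ)
    (A : Fin k → Fin (k + m) → ℝ) (j : Fin k) (v : Fin (k + m) → ℝ) :
    (Matrix.fromRows (Matrix.of (Function.update A j v)) B).submatrix id finSumFinEquiv =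
      ((Matrix.fromRows (Matrix.of A) B).submatrix id finSumFinEquiv).updateRow (Sum.inl j)
        (v ∘ finSumFinEquiv) := by
  ext (a | a) b
  · by_cases hab : a = j
    · subst hab; simp
    · simp [hab, Matrix.updateRow_apply]
  · simp [Matrix.updateRow_apply]

/-- The determinant of `A` stacked on a fixed `B`, as a multilinear map in the rows of `A`. -/
def stackDet {k m : ℕ} (B : Matrix (Fin m) (Fin (k + m)) ℝ) :
    MultilinearMap ℝ (fun _ : Fin k => Fin (k + m) → ℝ) ℝ :=
  MultilinearMap.mk'
    (fun A => ((Matrix.fromRows (Matrix.of A) B).submatrix id finSumFinEquiv).det)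
    (fun A j x y => by
      simp only [fromRows_update_submatrix]
      exact Matrix.det_updateRow_add _ _ _ _)
    (fun A j c x => by
      simp only [fromRows_update_submatrix]
      exact Matrix.det_updateRow_smul _ _ _ _)

theorem stackDet_apply {k m : ℕ} (B : Matrix (Fin m) (Fin (k + m)) ℝ)
    (A : Fin k → Fin (k + m) → ℝ) :
    stackDet B A = ((Matrix.fromRows (Matrix.of A) B).submatrix id finSumFinEquiv).det := rfl

theorem stackDet_comp_perm {k m : ℕ} (B : Matrix (Fin m) (Fin (k + m)) ℝ)
    (A : Fin k → Fin (k + m) → ℝ) (σ : Equiv.Perm (Fin k)) :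
    stackDet B (A ∘ σ) = ((Equiv.Perm.sign σ : ℤ) : ℝ) * stackDet B A := by
  have hs : Equiv.Perm.sign σ =
      Equiv.Perm.sign (Equiv.Perm.sumCongr σ (1 : Equiv.Perm (Fin m))) := by
    simp [Equiv.Perm.sign_sumCongr]
  rw [hs, stackDet_apply, stackDet_apply, ← Matrix.det_permute]
  congr 1
  ext (a | a) b <;> simp

theorem stackDet_eq_zero_of_row_eq {k m : ℕ} (B : Matrix (Fin m) (Fin (k + m)) ℝ)
    (A : Fin k → Fin (k + m) → ℝ) {a : Fin k} {t : Fin m} (h : A a = B t) :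
    stackDet B A = 0 := by
  rw [stackDet_apply]
  refine Matrix.det_zero_of_row_eq (i := Sum.inl a) (j := Sum.inr t) (by simp) ?_
  funext b
  simp [h]

theorem stackDet_rows {n k m : ℕ} (Z : Matrix (Fin n) (Fin (k + m)) ℝ)
    (g : Fin k → Fin n) (q : Fin m → Fin n) :
    stackDet (Z.submatrix q id) (fun a => Z (g a)) = (Z.submatrix (Fin.append g q) id).det := by
  rw [stackDet_apply, ← Matrix.det_submatrix_equiv_self finSumFinEquiv (Z.submatrix _ id)]
  congr 1
  ext (a | a) b <;> simp

/-- A symmetrized Cauchy-Binet expansion of a stacked determinant. -/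
theorem factorial_mul_stackDet_mul {n k m : ℕ} (C : Matrix (Fin k) (Fin n) ℝ)
    (Z : Matrix (Fin n) (Fin (k + m)) ℝ) (B : Matrix (Fin m) (Fin (k + m)) ℝ) :
    (k.factorial : ℝ) * stackDet B (C * Z) =
      ∑ f : Fin k → Fin n, (C.submatrix id f).det * stackDet B (fun a => Z (f a)) := by
  have hexp : stackDet B (C * Z) =
      ∑ f : Fin k → Fin n, (∏ a, C a (f a)) * stackDet B (fun a => Z (f a)) := by
    have hrow : (C * Z : Matrix _ _ ℝ) = fun a => ∑ x, C a x • Z x := by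
      funext a b
      simp [Matrix.mul_apply]
    rw [hrow, MultilinearMap.map_sum]
    refine Finset.sum_congr rfl fun f _ => ?_
    rw [MultilinearMap.map_smul_univ, smul_eq_mul]
  have hperm (σ : Equiv.Perm (Fin k)) : stackDet B (C * Z) =
      ∑ f : Fin k → Fin n, ((Equiv.Perm.sign σ : ℤ) : ℝ) * (∏ a, C a (f (σ a))) *
        stackDet B (fun a => Z (f a)) := by
    rw [hexp, ← (Equiv.arrowCongr σ.symm (Equiv.refl (Fin n))).sum_comp]
    refine Finset.sum_congr rfl fun f _ => ?_
    have := stackDet_comp_perm B (fun a => Z (f a)) σ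
    simp only [Function.comp_def] at this
    simp only [Equiv.arrowCongr_apply, Equiv.symm_symm, Function.comp_apply, Equiv.refl_apply,
      this]
    ring
  have hdet (f : Fin k → Fin n) : (C.submatrix id f).det =
      ∑ σ : Equiv.Perm (Fin k), ((Equiv.Perm.sign σ : ℤ) : ℝ) * ∏ a, C a (f (σ a)) := by
    rw [← Matrix.det_transpose, Matrix.det_apply']
    rfl
  simp only [hdet, Finset.sum_mul]
  rw [Finset.sum_comm, ← Finset.sum_congr rfl fun σ _ => hperm σ]
  simp [Fintype.card_perm]

/-- Each term of the expansion of a stacked determinant has the expected sign. -/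
theorem minor_mul_stackDet_nonneg {n k m : ℕ} {C : Matrix (Fin k) (Fin n) ℝ}
    (hC : IsTotallyNonnegRect C) {Z : Matrix (Fin n) (Fin (k + m)) ℝ} (hZ : IsPositiveMatrix Z)
    {q : Fin m → Fin n} (hq : StrictMono q)
    (hodd : ∀ x, (∀ t, x ≠ q t) → ∏ t, (if x < q t then (1 : ℝ) else -1) = -1)
    (f : Fin k → Fin n) :
    0 ≤ (-1 : ℝ) ^ k * ((C.submatrix id f).det *
        stackDet (Z.submatrix q id) (fun a => Z (f a))) ∧
      ((∀ a t, f a ≠ q t) →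
        (-1 : ℝ) ^ k * ((C.submatrix id f).det *
          stackDet (Z.submatrix q id) (fun a => Z (f a))) = 0 →
        (C.submatrix id f).det = 0) := by
  by_cases hinj : Function.Injective f
  swap
  · have h0 : (C.submatrix id f).det = 0 := by
      simp only [Function.Injective, not_forall] at hinj
      obtain ⟨a, b, hab, hne⟩ := hinj
      exact Matrix.det_zero_of_column_eq hne fun c => by simp [hab]
    simp [h0]
  by_cases hav : ∀ a t, f a ≠ q t
  swap
  · refine ⟨?_, fun h => absurd h hav⟩
    push Not at hav
    obtain ⟨a, t, hat⟩ := hav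
    rw [stackDet_eq_zero_of_row_eq _ _ (a := a) (t := t) (by funext b; simp [hat])]
    simp
  set s := Tuple.sort f
  have hmono : StrictMono (f ∘ s) :=
    (Tuple.monotone_sort f).strictMono_of_injective (hinj.comp s.injective)
  have hpos : 0 < (-1 : ℝ) ^ k * stackDet (Z.submatrix q id) (fun a => Z ((f ∘ s) a)) := by
    rw [stackDet_rows, ← prod_inversions_append hmono hq fun a => hodd _ (hav _)]
    refine hZ.prod_inversions_mul_det_pos ?_
    rw [Fin.append_injective_iff]
    exact ⟨hmono.injective, hq.injective, fun a t => hav _ _⟩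
  have hD : (C.submatrix id (f ∘ s)).det =
      ((Equiv.Perm.sign s : ℤ) : ℝ) * (C.submatrix id f).det := by
    rw [← Matrix.det_permute']
    rfl
  have hS := stackDet_comp_perm (Z.submatrix q id) (fun a => Z (f a)) s
  have hterm : (C.submatrix id f).det * stackDet (Z.submatrix q id) (fun a => Z (f a)) =
      (C.submatrix id (f ∘ s)).det *
        stackDet (Z.submatrix q id) (fun a => Z ((f ∘ s) a)) := by
    have hsq : ((Equiv.Perm.sign s : ℤ) : ℝ) * ((Equiv.Perm.sign s : ℤ) : ℝ) = 1 := by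
      rw [← Int.cast_mul, Int.units_coe_mul_self, Int.cast_one]
    simp only [Function.comp_def] at hS hD ⊢
    rw [hS, hD]
    linear_combination (-(C.submatrix id f).det *
      stackDet (Z.submatrix q id) (fun a => Z (f a))) * hsq
  rw [hterm, mul_left_comm]
  refine ⟨mul_nonneg (hC _ hmono) hpos.le, fun _ h => ?_⟩
  rw [hD] at h
  have h' := (mul_eq_zero.1 h).resolve_right hpos.ne'
  simpa using h'

/-- A stacked determinant with totally nonnegative coefficients has a definite sign. -/
theorem stackDet_mul_sign {n k m : ℕ} {C : Matrix (Fin k) (Fin n) ℝ}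
    (hC : IsTotallyNonnegRect C) (hrank : C.rank = k)
    {Z : Matrix (Fin n) (Fin (k + m)) ℝ} (hZ : IsPositiveMatrix Z)
    {q : Fin m → Fin n} (hq : StrictMono q)
    (hodd : ∀ x, (∀ t, x ≠ q t) → ∏ t, (if x < q t then (1 : ℝ) else -1) = -1) :
    0 ≤ (-1 : ℝ) ^ k * stackDet (Z.submatrix q id) (C * Z) ∧
      ((-1 : ℝ) ^ k * stackDet (Z.submatrix q id) (C * Z) = 0 ↔
        ∃ v ∈ rowSpace C, v ≠ 0 ∧ ∀ x, (∀ t, x ≠ q t) → v x = 0) := by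
  have hfac : (0 : ℝ) < k.factorial := by exact_mod_cast k.factorial_pos
  have hsum : (k.factorial : ℝ) * ((-1 : ℝ) ^ k * stackDet (Z.submatrix q id) (C * Z)) =
      ∑ f : Fin k → Fin n, (-1 : ℝ) ^ k * ((C.submatrix id f).det *
        stackDet (Z.submatrix q id) (fun a => Z (f a))) := by
    rw [mul_left_comm, factorial_mul_stackDet_mul, Finset.mul_sum]
  have hterm := minor_mul_stackDet_nonneg hC hZ hq hodd
  have hli : LinearIndependent ℝ C.row := by
    rw [linearIndependent_iff_card_eq_finrank_span, Fintype.card_fin, Set.finrank,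
      ← Matrix.rank_eq_finrank_span_row, hrank]
  have hmem (v : Fin n → ℝ) : v ∈ rowSpace C ↔ ∃ w, Matrix.vecMul w C = v := by
    change v ∈ Submodule.span ℝ (Set.range C.row) ↔ _
    rw [← range_vecMulLinear]
    rfl
  refine ⟨nonneg_of_mul_nonneg_right (hsum ▸ Finset.sum_nonneg fun f _ => (hterm f).1) hfac, ?_⟩
  constructor
  · intro h0
    rw [h0, mul_zero, eq_comm, Finset.sum_eq_zero_iff_of_nonneg fun f _ => (hterm f).1] at hsum
    obtain ⟨w, hw, hwC⟩ := exists_vecMul_eq_zero_of_forall_minor_eq_zero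
      (C.submatrix id (Subtype.val : {x // ∀ t, x ≠ q t} → Fin n)) fun f =>
        (hterm fun a => (f a).1).2 (fun a => (f a).2) (hsum _ (Finset.mem_univ _))
    refine ⟨Matrix.vecMul w C, (hmem _).2 ⟨w, rfl⟩, fun h => hw ?_, fun x hx => ?_⟩
    · exact Matrix.vecMul_injective_iff.2 hli (by simpa using h)
    · exact congrFun hwC ⟨x, hx⟩
  · rintro ⟨v, hv, hv0, hsupp⟩
    obtain ⟨w, rfl⟩ := (hmem v).1 hv
    have hw : w ≠ 0 := by
      rintro rfl
      simp at hv0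
    rw [← mul_right_inj' hfac.ne', hsum, mul_zero]
    refine Finset.sum_eq_zero fun f _ => ?_
    by_cases hav : ∀ a t, f a ≠ q t
    · have : (C.submatrix id f).det = 0 := by
        rw [← Matrix.exists_vecMul_eq_zero_iff]
        exact ⟨w, hw, funext fun a => hsupp (f a) (hav a)⟩
      simp [this]
    · push Not at hav
      obtain ⟨a, t, hat⟩ := hav
      rw [stackDet_eq_zero_of_row_eq _ _ (a := a) (t := t) (by funext b; simp [hat])]
      simp

theorem twistor_eq_stackDet {n k : ℕ} (Z : Matrix (Fin n) (Fin (k + 4)) ℝ)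
    (Y : Matrix (Fin k) (Fin (k + 4)) ℝ) {a : Fin 4 → ℕ} {q : Fin 4 → Fin n}
    (h : ∀ t, a t - 1 = q t) : twistor Z Y a = stackDet (Z.submatrix q id) Y := by
  change _ = ((Matrix.fromRows Y (Z.submatrix q id)).submatrix id finSumFinEquiv).det
  rw [twistor, ← Matrix.det_submatrix_equiv_self finSumFinEquiv]
  congr 1
  ext (x | x) b <;> simp [markerRow, h]

/-- Let `Z` be a positive `n × (k+4)` real matrix and `C` a totally
nonnegative `k × n` real matrix of rank `k`.  For all (1-based) indices `i` with
`2 ≤ i` and `i + 1 ≤ n - 1`, the quantity `(-1)^k · ⟨(CZ) 1 i (i+1) n⟩` is nonnegative,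
and it vanishes iff the row space of `C` contains a nonzero vector supported on the
coordinates `{1, i, i+1, n}`. -/
theorem boundary_twistor_1iip1n_sign
    (k n : ℕ) (hk : 1 ≤ k) (hn : k + 4 ≤ n)
    (Z : Matrix (Fin n) (Fin (k + 4)) ℝ) (hZ : IsPositiveMatrix Z)
    (C : Matrix (Fin k) (Fin n) ℝ) (hC : IsTotallyNonnegRect C) (hrank : C.rank = k)
    (i : ℕ) (h2 : 2 ≤ i) (hin : i + 1 ≤ n - 1) :
    0 ≤ (-1 : ℝ) ^ k * twistor Z (C * Z) ![1, i, i + 1, n] ∧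
      ((-1 : ℝ) ^ k * twistor Z (C * Z) ![1, i, i + 1, n] = 0 ↔
        ∃ v ∈ rowSpace C, v ≠ 0 ∧
          ∀ a : Fin n, (a : ℕ) + 1 ∉ ({1, i, i + 1, n} : Finset ℕ) → v a = 0) := by
  let q : Fin 4 → Fin n :=
    ![⟨0, by omega⟩, ⟨i - 1, by omega⟩, ⟨i, by omega⟩, ⟨n - 1, by omega⟩]
  have hq : StrictMono q := by
    rw [Fin.strictMono_iff_lt_succ]
    intro t
    fin_cases t <;> simp [q, Fin.lt_def] <;> omega
  have hne (x : Fin n) :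
      (∀ t, x ≠ q t) ↔ (x : ℕ) + 1 ∉ ({1, i, i + 1, n} : Finset ℕ) := by
    have := x.2
    simp only [Fin.forall_fin_succ, q, Finset.mem_insert, Finset.mem_singleton]
    simp [Fin.ext_iff]
    omega
  have hodd (x : Fin n) (hx : ∀ t, x ≠ q t) :
      ∏ t, (if x < q t then (1 : ℝ) else -1) = -1 := by
    have hlt := x.2
    rw [hne] at hx
    simp only [Finset.mem_insert, Finset.mem_singleton, not_or] at hx
    have e0 : ¬ x < q 0 := by simp [q, Fin.lt_def]
    have e3 : x < q 3 := by simp [q, Fin.lt_def]; omega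
    have e12 : x < q 1 ↔ x < q 2 := by simp [q, Fin.lt_def]; omega
    simp only [Fin.prod_univ_four, e0, e3, e12]
    by_cases h' : x < q 2 <;> simp [h']
  have htw : twistor Z (C * Z) ![1, i, i + 1, n] = stackDet (Z.submatrix q id) (C * Z) := by
    refine twistor_eq_stackDet Z _ fun t => ?_
    fin_cases t <;> simp [q]
  rw [htw]
  simpa only [hne] using stackDet_mul_sign hC hrank hZ hq hodd

end
end

section
/- Let k ≥ 0, let Y ∈ Mat_{k×(k+4)}(ℝ), and let u, u′, v, v′, w, w′, z ∈ ℝ^{k+4}. For vectors a, b, c, d ∈ ℝ^{k+4} write ⟨a b c d⟩ for the determinant of the (k+4)×(k+4) matrix whose rows are the k rows of Y followed by a, b, c, d, and define F(a a′; b b′; c c′) := ⟨a b b′ z⟩·⟨a′ c c′ z⟩ − ⟨a′ b b′ z⟩·⟨a c c′ z⟩. Then F(u u′; v v′; w w′) = −F(u u′; w w′; v v′) = F(v v′; w w′; u u′) = −F(w w′; v v′; u u′) = F(w w′; u u′; v v′) = −F(v v′; u u′; w w′). -/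
open scoped Classical

noncomputable section

/-- `⟨a b c d⟩`: the determinant of the `(k+4) × (k+4)` matrix whose rows are the `k` rows
of `Y` followed by the vectors `a, b, c, d`. -/
def rowsDet {k : ℕ} (Y : Matrix (Fin k) (Fin (k + 4)) ℝ)
    (a b c d : Fin (k + 4) → ℝ) : ℝ :=
  ((Matrix.fromRows Y (Matrix.of ![a, b, c, d])).submatrix (⇑finSumFinEquiv.symm) id).det

/-- The two-term quadratic functionary
`F(a a'; b b'; c c') = ⟨a b b' z⟩·⟨a' c c' z⟩ − ⟨a' b b' z⟩·⟨a c c' z⟩`. -/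
def quadFun {k : ℕ} (Y : Matrix (Fin k) (Fin (k + 4)) ℝ) (z : Fin (k + 4) → ℝ)
    (a a' b b' c c' : Fin (k + 4) → ℝ) : ℝ :=
  rowsDet Y a b b' z * rowsDet Y a' c c' z - rowsDet Y a' b b' z * rowsDet Y a c c' z

open Matrix in
/-- The quadratic Plücker relation: exchange the row `x` placed at position `i` of `B` with each row
of `A` in turn. -/
theorem Matrix.det_mul_det_updateRow_eq_sum {n R : Type*} [Fintype n] [DecidableEq n] [CommRing R]
    (A B : Matrix n n R) (i : n) (x : n → R) :
    A.det * (B.updateRow i x).det =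
      ∑ j, (A.updateRow j x).det * (B.updateRow i (A j)).det := by
  have hx : A.det • x = ∑ j, (A.updateRow j x).det • A j := by
    have h := mulVec_cramer Aᵀ x
    rw [det_transpose] at h
    rw [← h, mulVec_transpose, vecMul_eq_sum]
    simp only [cramer_transpose_apply]
  have h := congrArg ((detRowAlternating (R := R) (n := n)).toMultilinearMap.toLinearMap B i) hx
  simp only [map_smul, map_sum, smul_eq_mul] at h
  exact h

/-- The square matrix whose rows are those of `Y` followed by the four rows `r`. -/
def stackRows {k : ℕ} (Y : Matrix (Fin k) (Fin (k + 4)) ℝ) (r : Fin 4 → Fin (k + 4) → ℝ) :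
    Matrix (Fin (k + 4)) (Fin (k + 4)) ℝ :=
  (Matrix.fromRows Y (Matrix.of r)).submatrix (⇑finSumFinEquiv.symm) id

theorem rowsDet_eq_det_stackRows {k : ℕ} (Y : Matrix (Fin k) (Fin (k + 4)) ℝ)
    (a b c d : Fin (k + 4) → ℝ) : rowsDet Y a b c d = (stackRows Y ![a, b, c, d]).det :=
  rfl

theorem stackRows_castAdd {k : ℕ} (Y : Matrix (Fin k) (Fin (k + 4)) ℝ)
    (r : Fin 4 → Fin (k + 4) → ℝ) (l : Fin k) : stackRows Y r (Fin.castAdd 4 l) = Y l := by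
  funext m
  simp [stackRows]

theorem stackRows_natAdd {k : ℕ} (Y : Matrix (Fin k) (Fin (k + 4)) ℝ)
    (r : Fin 4 → Fin (k + 4) → ℝ) (l : Fin 4) : stackRows Y r (Fin.natAdd k l) = r l := by
  funext m
  simp [stackRows]

theorem castAdd_ne_natAdd {k n : ℕ} (i : Fin k) (j : Fin n) :
    Fin.castAdd n i ≠ Fin.natAdd k j := by
  intro h
  have := congrArg Fin.val h
  simp only [Fin.val_castAdd, Fin.val_natAdd] at this
  omega

theorem updateRow_stackRows {k : ℕ} (Y : Matrix (Fin k) (Fin (k + 4)) ℝ)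
    (r : Fin 4 → Fin (k + 4) → ℝ) (i : Fin 4) (x : Fin (k + 4) → ℝ) :
    (stackRows Y r).updateRow (Fin.natAdd k i) x = stackRows Y (Function.update r i x) := by
  funext l
  refine Fin.addCases (fun l => ?_) (fun l => ?_) l
  · rw [stackRows_castAdd, Matrix.updateRow_ne (castAdd_ne_natAdd l i), stackRows_castAdd]
  · rw [stackRows_natAdd]
    by_cases h : l = i
    · subst h
      simp
    · rw [Matrix.updateRow_ne (by simpa using h), stackRows_natAdd, Function.update_of_ne h]

theorem det_stackRows_comp_swap {k : ℕ} (Y : Matrix (Fin k) (Fin (k + 4)) ℝ)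
    (r : Fin 4 → Fin (k + 4) → ℝ) {i j : Fin 4} (hij : i ≠ j) :
    (stackRows Y (r ∘ Equiv.swap i j)).det = -(stackRows Y r).det := by
  have hne : Fin.natAdd k i ≠ Fin.natAdd k j := by simpa using hij
  have h : stackRows Y (r ∘ Equiv.swap i j) =
      (stackRows Y r).submatrix (Equiv.swap (Fin.natAdd k i) (Fin.natAdd k j)) id := by
    ext l m
    rw [Matrix.submatrix_apply]
    refine Fin.addCases (fun l => ?_) (fun l => ?_) l
    · rw [Equiv.swap_apply_of_ne_of_ne (castAdd_ne_natAdd l i) (castAdd_ne_natAdd l j),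
        stackRows_castAdd, stackRows_castAdd, id]
    · rw [(Fin.natAdd_injective 4 k).swap_apply, stackRows_natAdd, stackRows_natAdd,
        Function.comp_apply, id]
  rw [h, Matrix.det_permute, Equiv.Perm.sign_swap hne]
  simp

theorem rowsDet_swap_fst_snd {k : ℕ} (Y : Matrix (Fin k) (Fin (k + 4)) ℝ)
    (a b c d : Fin (k + 4) → ℝ) : rowsDet Y b a c d = -rowsDet Y a b c d := by
  rw [rowsDet_eq_det_stackRows, rowsDet_eq_det_stackRows,
    ← det_stackRows_comp_swap Y _ (show (0 : Fin 4) ≠ 1 by decide)]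
  congr 3
  funext l
  fin_cases l <;> rfl

theorem rowsDet_swap_snd_trd {k : ℕ} (Y : Matrix (Fin k) (Fin (k + 4)) ℝ)
    (a b c d : Fin (k + 4) → ℝ) : rowsDet Y a c b d = -rowsDet Y a b c d := by
  rw [rowsDet_eq_det_stackRows, rowsDet_eq_det_stackRows,
    ← det_stackRows_comp_swap Y _ (show (1 : Fin 4) ≠ 2 by decide)]
  congr 3
  funext l
  fin_cases l <;> rfl

theorem rowsDet_mul_rowsDet {k : ℕ} (Y : Matrix (Fin k) (Fin (k + 4)) ℝ)
    (a b c x p q z : Fin (k + 4) → ℝ) :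
    rowsDet Y a b c z * rowsDet Y x p q z =
      rowsDet Y x b c z * rowsDet Y a p q z + rowsDet Y a x c z * rowsDet Y b p q z +
        rowsDet Y a b x z * rowsDet Y c p q z := by
  have h := Matrix.det_mul_det_updateRow_eq_sum (stackRows Y ![a, b, c, z])
    (stackRows Y ![x, p, q, z]) (Fin.natAdd k 0) x
  have hY : ∀ j, (stackRows Y ![Y j, p, q, z]).det = 0 := fun j =>
    Matrix.det_zero_of_row_eq (i := Fin.castAdd 4 j) (j := Fin.natAdd k 0)
      (castAdd_ne_natAdd j 0) (by rw [stackRows_castAdd, stackRows_natAdd]; rfl)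
  have hz : (stackRows Y ![z, p, q, z]).det = 0 :=
    Matrix.det_zero_of_row_eq (i := Fin.natAdd k 0) (j := Fin.natAdd k 3)
      (by simp) (by rw [stackRows_natAdd, stackRows_natAdd]; rfl)
  have h0 : ∀ s y : Fin (k + 4) → ℝ, Function.update ![y, p, q, z] 0 s = ![s, p, q, z] :=
    fun s y => by funext l; fin_cases l <;> rfl
  have e0 : Function.update ![a, b, c, z] 0 x = ![x, b, c, z] := by
    funext l; fin_cases l <;> rfl
  have e1 : Function.update ![a, b, c, z] 1 x = ![a, x, c, z] := by
    funext l; fin_cases l <;> rfl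
  have e2 : Function.update ![a, b, c, z] 2 x = ![a, b, x, z] := by
    funext l; fin_cases l <;> rfl
  simp only [updateRow_stackRows, Fin.sum_univ_add, h0, stackRows_castAdd, stackRows_natAdd, hY,
    Fin.sum_univ_four, e0, e1, e2, mul_zero, Finset.sum_const_zero, zero_add] at h
  simpa [rowsDet_eq_det_stackRows, hz] using h

theorem quadFun_swap_snd_trd {k : ℕ} (Y : Matrix (Fin k) (Fin (k + 4)) ℝ)
    (z a a' b b' c c' : Fin (k + 4) → ℝ) :
    quadFun Y z a a' b b' c c' = -quadFun Y z a a' c c' b b' := by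
  unfold quadFun
  ring

theorem quadFun_rotate {k : ℕ} (Y : Matrix (Fin k) (Fin (k + 4)) ℝ)
    (z a a' b b' c c' : Fin (k + 4) → ℝ) :
    quadFun Y z a a' b b' c c' = quadFun Y z b b' c c' a a' := by
  have h := rowsDet_mul_rowsDet Y a b b' a' c c' z
  rw [rowsDet_swap_snd_trd Y a b' a' z, rowsDet_swap_fst_snd Y b' a a' z,
    rowsDet_swap_fst_snd Y b a a' z] at h
  unfold quadFun
  linear_combination h

/-- The six-fold (anti)symmetry of the two-term quadratic functionary:
`F(u u'; v v'; w w') = −F(u u'; w w'; v v') = F(v v'; w w'; u u') = −F(w w'; v v'; u u')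
= F(w w'; u u'; v v') = −F(v v'; u u'; w w')`. -/
theorem quadFun_six_symmetries (k : ℕ) (Y : Matrix (Fin k) (Fin (k + 4)) ℝ)
    (u u' v v' w w' z : Fin (k + 4) → ℝ) :
    quadFun Y z u u' v v' w w' = -quadFun Y z u u' w w' v v' ∧
    quadFun Y z u u' v v' w w' = quadFun Y z v v' w w' u u' ∧
    quadFun Y z u u' v v' w w' = -quadFun Y z w w' v v' u u' ∧
    quadFun Y z u u' v v' w w' = quadFun Y z w w' u u' v v' ∧
    quadFun Y z u u' v v' w w' = -quadFun Y z v v' u u' w w' := by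
  have h := quadFun_rotate Y z u u' v v' w w'
  have h' := h.trans (quadFun_rotate Y z v v' w w' u u')
  exact ⟨quadFun_swap_snd_trd .., h, h'.trans (quadFun_swap_snd_trd ..), h',
    h.trans (quadFun_swap_snd_trd ..)⟩

end
end

section
/- Let k ≥ 0 and m ≥ 1, let Y ∈ Mat_{k×(k+m)}(ℝ), let z_1, …, z_{m+1} ∈ ℝ^{k+m}, and let c_1, …, c_{m+1} ∈ ℝ be such that the vector Σ_{h=1}^{m+1} c_h z_h lies in the row space of Y. For p ∈ {1,…,m+1} write D_p for the determinant of the (k+m)×(k+m) matrix whose rows are the k rows of Y followed by z_1,…,z_{p−1},z_{p+1},…,z_{m+1} (the p-th vector omitted, the rest in order). Then for all p, q ∈ {1,…,m+1}: (−1)^p·c_p·D_q = (−1)^q·c_q·D_p. -/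
open scoped Classical

noncomputable section

open Matrix in
/-- The entries of a vector in the left kernel of an `(n + 1) × n` matrix are proportional to the
signed maximal minors of that matrix. -/
theorem neg_one_pow_mul_det_succAbove_of_vecMul_eq_zero {R : Type*} [CommRing R] {n : ℕ}
    (M : Matrix (Fin (n + 1)) (Fin n) R) (v : Fin (n + 1) → R) (hv : v ᵥ* M = 0)
    (i j : Fin (n + 1)) :
    (-1) ^ (j : ℕ) * (M.submatrix j.succAbove id).det * v i =
      v j * ((-1) ^ (i : ℕ) * (M.submatrix i.succAbove id).det) := by
  let A : Matrix (Fin (n + 1)) (Fin (n + 1)) R :=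
    of fun r => Fin.cons ((Pi.single j 1 : Fin (n + 1) → R) r) (M r)
  have hminor (r : Fin (n + 1)) : A.submatrix r.succAbove Fin.succ = M.submatrix r.succAbove id := by
    ext a b
    simp [A]
  have hdet : A.det = (-1) ^ (j : ℕ) * (M.submatrix j.succAbove id).det := by
    rw [det_succ_column_zero, Finset.sum_eq_single j]
    · simp [hminor, A]
    · intro r _ hr
      simp [A, Pi.single_eq_of_ne hr]
    · simp
  have hvA : v ᵥ* A = Pi.single 0 (v j) := by
    ext s
    refine Fin.cases ?_ (fun t => ?_) s
    · simp [vecMul, dotProduct, A, Pi.single_apply]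
    · simpa [vecMul, dotProduct, A] using congrFun hv t
  have hadj : A.adjugate 0 i = (-1) ^ (i : ℕ) * (M.submatrix i.succAbove id).det := by
    rw [adjugate_fin_succ_eq_det_submatrix, ← hminor]
    simp [Fin.succAbove_zero]
  have h := congrFun (vecMul_vecMul v A A.adjugate) i
  rw [mul_adjugate, hvA, single_vecMul, vecMul_smul, vecMul_one] at h
  simpa [hadj, hdet] using h.symm

/-- Omitting row `k + p` from the stack of `Y` and `z` omits the row `p` of `z`. -/
theorem fromRows_submatrix_natAdd_succAbove {R : Type*} {k m : ℕ} {n : Type*}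
    (Y : Matrix (Fin k) n R) (z : Fin (m + 1) → n → R) (p : Fin (m + 1)) :
    ((Matrix.fromRows Y (Matrix.of z)).submatrix finSumFinEquiv.symm id).submatrix
        (Fin.succAbove (n := k + m) (Fin.natAdd k p)) id =
      (Matrix.fromRows Y (Matrix.of fun t : Fin m => z (p.succAbove t))).submatrix
        (⇑finSumFinEquiv.symm) id := by
  ext a b
  refine Fin.addCases (fun r => ?_) (fun t => ?_) a
  · have h : Fin.succAbove (n := k + m) (Fin.natAdd k p) (Fin.castAdd m r) =
        Fin.castAdd (m + 1) r := by
      rw [Fin.succAbove_of_castSucc_lt _ _ (by simp [Fin.lt_def]; omega)]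
      rfl
    simp [h]
  · have h : Fin.succAbove (n := k + m) (Fin.natAdd k p) (Fin.natAdd k t) =
        Fin.natAdd k (p.succAbove t) := by
      ext
      simp only [Fin.succAbove, Fin.lt_def, Fin.val_castSucc, Fin.val_natAdd,
        Nat.add_lt_add_iff_left]
      split_ifs <;> simp [add_assoc]
    simp [h]

/-- **Cramer-type proportionality.** Let `Y` be a real `k × (k+m)` matrix
(`k ≥ 0`, `m ≥ 1`), let `z_0, …, z_m ∈ ℝ^(k+m)` and `c_0, …, c_m ∈ ℝ` be such that
`∑ h, c h • z h` lies in the row space of `Y`.  For `p : Fin (m+1)` let `D p` be the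
determinant of the `(k+m) × (k+m)` matrix whose rows are the rows of `Y` followed by
`z_0, …, z_{p-1}, z_{p+1}, …, z_m` (the `p`-th vector omitted, the rest in order).
Then `(-1)^p · c p · D q = (-1)^q · c q · D p` for all `p, q`. -/
theorem cramer_proportionality
    (k m : ℕ) (hm : 1 ≤ m)
    (Y : Matrix (Fin k) (Fin (k + m)) ℝ)
    (z : Fin (m + 1) → Fin (k + m) → ℝ) (c : Fin (m + 1) → ℝ)
    (hmem : (∑ h : Fin (m + 1), c h • z h) ∈
      Submodule.span ℝ (Set.range fun r => Y r))
    (D : Fin (m + 1) → ℝ)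
    (hD : ∀ p : Fin (m + 1),
      D p = ((Matrix.fromRows Y (Matrix.of fun t : Fin m => z (p.succAbove t))).submatrix
        (⇑finSumFinEquiv.symm) id).det) :
    ∀ p q : Fin (m + 1),
      (-1 : ℝ) ^ (p : ℕ) * c p * D q = (-1 : ℝ) ^ (q : ℕ) * c q * D p := by
  obtain ⟨b, hb⟩ := (Submodule.mem_span_range_iff_exists_fun ℝ).1 hmem
  have hker : Matrix.vecMul (Fin.append (-b) c)
      ((Matrix.fromRows Y (Matrix.of z)).submatrix finSumFinEquiv.symm id) = 0 := by
    ext s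
    have hs := congrFun hb s
    simp only [Finset.sum_apply, Pi.smul_apply, smul_eq_mul] at hs
    simp [Matrix.vecMul, dotProduct, Fin.sum_univ_add, hs]
  intro p q
  have h := neg_one_pow_mul_det_succAbove_of_vecMul_eq_zero _ _ hker
    (Fin.natAdd k p) (Fin.natAdd k q)
  rw [fromRows_submatrix_natAdd_succAbove, fromRows_submatrix_natAdd_succAbove, ← hD, ← hD,
    Fin.append_right, Fin.append_right, Fin.val_natAdd, Fin.val_natAdd, pow_add, pow_add] at h
  have hsq (a : ℕ) : ((-1 : ℝ) ^ a) ^ 2 = 1 := by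
    rw [← pow_mul, mul_comm, pow_mul, neg_one_sq, one_pow]
  have hk := hsq k
  have hp := hsq p
  have hq := hsq q
  grind

end
end

section
/- Let k ≥ 1 and n ≥ k+4, let Z ∈ Mat_{n×(k+4)}(ℝ) be positive, and let C ∈ Mat_{k×n}(ℝ) be totally nonnegative such that some row C_r of C is supported on the five consecutive indices J = {m, m+1, m+2, m+3, m+4} ⊆ [n] with C_r^{m+h} > 0 for all h = 0,…,4. Then there exists a real number λ ≥ 0 such that for every h = 0,…,4: (−1)^h·⟨(CZ) (J∖{m+h})⟩ = λ·C_r^{m+h}, where ⟨(CZ) (J∖{a})⟩ denotes the twistor whose four Z-row indices are the elements of J∖{a} in increasing order. -/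
open scoped Classical

noncomputable section

/-- A symmetrized Cauchy–Binet formula. -/
theorem factorial_mul_det_mul {N n : ℕ} (D : Matrix (Fin N) (Fin n) ℝ)
    (Z : Matrix (Fin n) (Fin N) ℝ) :
    (N.factorial : ℝ) * (D * Z).det =
      ∑ f : Fin N → Fin n, (D.submatrix id f).det * (Z.submatrix f id).det := by
  have expand : (D * Z).det = ∑ f : Fin N → Fin n, (∏ i, D i (f i)) * (Z.submatrix f id).det := by
    have rows : D * Z = fun i => ∑ a, D i a • Z a := by
      ext i j
      simp [Matrix.mul_apply, Finset.sum_apply]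
    change Matrix.detRowAlternating.toMultilinearMap (D * Z) = _
    rw [rows, MultilinearMap.map_sum]
    refine Finset.sum_congr rfl fun f _ => ?_
    rw [MultilinearMap.map_smul_univ, smul_eq_mul]
    rfl
  have permuted (σ : Equiv.Perm (Fin N)) : (D * Z).det = ∑ f : Fin N → Fin n,
      ((Equiv.Perm.sign σ : ℤ) : ℝ) * (∏ i, D i (f (σ i))) * (Z.submatrix f id).det := by
    rw [expand, ← Equiv.sum_comp (Equiv.arrowCongr σ.symm (Equiv.refl (Fin n)))]
    refine Finset.sum_congr rfl fun f _ => ?_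
    have := Matrix.det_permute σ (Z.submatrix f id)
    simp only [Matrix.submatrix_submatrix] at this
    simp only [Equiv.arrowCongr_apply, Equiv.symm_symm, Equiv.coe_refl,
      Function.comp_apply]
    rw [mul_comm (((Equiv.Perm.sign σ : ℤ) : ℝ)), mul_assoc, ← this]
    rfl
  calc (N.factorial : ℝ) * (D * Z).det = ∑ σ : Equiv.Perm (Fin N), (D * Z).det := by
        simp [Fintype.card_perm]
    _ = _ := by
        rw [Finset.sum_congr rfl fun σ _ => permuted σ, Finset.sum_comm]
        refine Finset.sum_congr rfl fun f _ => ?_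
        rw [← Finset.sum_mul, ← Matrix.det_transpose (D.submatrix id f),
          Matrix.det_apply' (D.submatrix id f).transpose]
        rfl

theorem IsTotallyNonnegRect.det_mul_nonneg {N n : ℕ} {D : Matrix (Fin N) (Fin n) ℝ}
    {Z : Matrix (Fin n) (Fin N) ℝ} (hD : IsTotallyNonnegRect D) (hZ : IsPositiveMatrix Z) :
    0 ≤ (D * Z).det := by
  refine nonneg_of_mul_nonneg_right ?_ (Nat.cast_pos.mpr N.factorial_pos : (0 : ℝ) < _)
  rw [factorial_mul_det_mul]
  refine Finset.sum_nonneg fun f _ => ?_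
  by_cases hf : Function.Injective f
  · set σ := Tuple.sort f
    have mono : StrictMono (f ∘ σ) :=
      (Tuple.monotone_sort f).strictMono_of_injective (hf.comp σ.injective)
    have hprod := mul_nonneg (hD _ mono) (hZ _ mono).le
    have hDσ := Matrix.det_permute' σ (D.submatrix id f)
    have hZσ := Matrix.det_permute σ (Z.submatrix f id)
    simp only [Matrix.submatrix_submatrix, Function.comp_id] at hDσ hZσ
    rw [hDσ, hZσ, mul_mul_mul_comm, ← Int.cast_mul, ← Units.val_mul,
      Int.units_mul_self] at hprod
    simpa using hprod
  · obtain ⟨i, j, hij, hne⟩ : ∃ i j, f i = f j ∧ i ≠ j := by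
      simpa [Function.Injective] using hf
    rw [Matrix.det_zero_of_row_eq hne (M := Z.submatrix f id) (by ext; simp [hij]), mul_zero]

/-- Expansion of a determinant whose last row is a standard basis vector. -/
theorem det_eq_of_last_row_single {N : ℕ} (A : Matrix (Fin (N + 1)) (Fin (N + 1)) ℝ)
    (c : Fin (N + 1)) (hc : ∀ j, A (Fin.last N) j = if j = c then 1 else 0) :
    A.det = (-1) ^ (N + (c : ℕ)) * (A.submatrix Fin.castSucc c.succAbove).det := by
  rw [Matrix.det_succ_row A (Fin.last N), Finset.sum_eq_single c]
  · simp [hc, Fin.succAbove_last]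
  · intro b _ hb
    simp [hc, hb]
  · simp

/-- Appending two consecutive standard basis vectors preserves total nonnegativity. -/
theorem IsTotallyNonnegRect.append_consecutive {k n : ℕ} {C : Matrix (Fin k) (Fin n) ℝ}
    (hC : IsTotallyNonnegRect C) {i j : Fin n} (hij : (i : ℕ) + 1 = j)
    (D : Matrix (Fin (k + 2)) (Fin n) ℝ) (hDC : ∀ t, D (Fin.castAdd 2 t) = C t)
    (hDi : D (Fin.natAdd k 0) = Pi.single i 1) (hDj : D (Fin.natAdd k 1) = Pi.single j 1) :
    IsTotallyNonnegRect D := by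
  intro g hg
  by_cases hi : ∃ c, g c = i
  swap
  · refine (Matrix.det_eq_zero_of_row_eq_zero (Fin.natAdd k 0) fun c => ?_).ge
    have hc : g c ≠ i := fun h => hi ⟨c, h⟩
    simp [hDi, hc]
  by_cases hj : ∃ c, g c = j
  swap
  · refine (Matrix.det_eq_zero_of_row_eq_zero (Fin.natAdd k 1) fun c => ?_).ge
    have hc : g c ≠ j := fun h => hj ⟨c, h⟩
    simp [hDj, hc]
  obtain ⟨b, hb⟩ := hi
  obtain ⟨c, hc⟩ := hj
  have hbc : b < c := hg.lt_iff_lt.mp (by rw [hb, hc, Fin.lt_def]; omega)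
  have hcb : (c : ℕ) = b + 1 := by
    by_contra hne
    have hlt : (b : ℕ) + 1 < c := by
      have := Fin.lt_def.mp hbc
      omega
    have h₁ : b < ⟨b + 1, by omega⟩ := Fin.lt_def.mpr (by simp)
    have h₂ : (⟨b + 1, by omega⟩ : Fin (k + 2)) < c := hlt
    have h₃ := Fin.lt_def.mp (hg h₁)
    have h₄ := Fin.lt_def.mp (hg h₂)
    rw [hb] at h₃
    rw [hc] at h₄
    omega
  let b' : Fin (k + 1) := ⟨b, by omega⟩
  have hb' : c.succAbove b' = b := by
    rw [Fin.succAbove_of_castSucc_lt _ _ hbc]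
    rfl
  rw [det_eq_of_last_row_single _ c, det_eq_of_last_row_single _ b', ← mul_assoc, ← pow_add]
  · rw [Even.neg_one_pow ⟨k + 1 + b, by simp only [b', hcb]; ring⟩, one_mul]
    convert hC (g ∘ c.succAbove ∘ b'.succAbove)
      (hg.comp ((Fin.strictMono_succAbove c).comp (Fin.strictMono_succAbove b'))) using 2
    ext s t
    exact congrFun (hDC s) _
  · intro l
    have h : D (Fin.castSucc (Fin.last k)) = Pi.single i 1 := hDi
    simp only [Matrix.submatrix_apply, id_eq, h, Pi.single_apply, ← hb, ← hb', hg.injective.eq_iff,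
      Fin.succAbove_right_inj]
  · intro l
    have h : D (Fin.last (k + 1)) = Pi.single j 1 := hDj
    simp only [Matrix.submatrix_apply, id_eq, h, Pi.single_apply, ← hc, hg.injective.eq_iff]

/-- The matrix whose rows are those of `Y` followed by the vectors `W`. -/
def appendRows {k q N : ℕ} (Y : Matrix (Fin k) (Fin N) ℝ) (W : Fin q → Fin N → ℝ) :
    Matrix (Fin (k + q)) (Fin N) ℝ :=
  Matrix.of (Fin.append (fun i => Y i) W)

@[simp]
theorem appendRows_castAdd {k q N : ℕ} (Y : Matrix (Fin k) (Fin N) ℝ) (W : Fin q → Fin N → ℝ)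
    (i : Fin k) : appendRows Y W (Fin.castAdd q i) = Y i :=
  Fin.append_left _ _ i

@[simp]
theorem appendRows_natAdd {k q N : ℕ} (Y : Matrix (Fin k) (Fin N) ℝ) (W : Fin q → Fin N → ℝ)
    (t : Fin q) : appendRows Y W (Fin.natAdd k t) = W t :=
  Fin.append_right _ _ t

theorem twistor_eq_det_append {n k : ℕ} (Z : Matrix (Fin n) (Fin (k + 4)) ℝ)
    (Y : Matrix (Fin k) (Fin (k + 4)) ℝ) (a : Fin 4 → ℕ) :
    twistor Z Y a = Matrix.det (appendRows Y fun t => markerRow Z (a t)) := by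
  unfold twistor
  congr 1
  funext i
  induction i using Fin.addCases <;> ext <;> simp [Matrix.fromRows] <;> rfl

/-- The twistor on two pairs of consecutive rows is nonnegative. -/
theorem det_append_consecutive_pairs_nonneg {k n : ℕ} {Z : Matrix (Fin n) (Fin (k + 4)) ℝ}
    (hZ : IsPositiveMatrix Z) {C : Matrix (Fin k) (Fin n) ℝ} (hC : IsTotallyNonnegRect C)
    (b : Fin 4 → Fin n) (h01 : (b 0 : ℕ) + 1 = b 1) (h23 : (b 2 : ℕ) + 1 = b 3) :
    0 ≤ Matrix.det (appendRows (C * Z) fun t => Z (b t)) := by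
  let D₁ : Matrix (Fin (k + 2)) (Fin n) ℝ := appendRows C ![Pi.single (b 0) 1, Pi.single (b 1) 1]
  let D : Matrix (Fin (k + 4)) (Fin n) ℝ :=
    appendRows (k := k + 2) (q := 2) D₁ ![Pi.single (b 2) 1, Pi.single (b 3) 1]
  have hD₁ : IsTotallyNonnegRect D₁ :=
    hC.append_consecutive h01 D₁ (fun t => appendRows_castAdd _ _ t) (appendRows_natAdd _ _ 0)
      (appendRows_natAdd _ _ 1)
  have hD : IsTotallyNonnegRect D :=
    hD₁.append_consecutive h23 D (fun t => appendRows_castAdd _ _ t) (appendRows_natAdd _ _ 0)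
      (appendRows_natAdd _ _ 1)
  have hDC (s : Fin k) : D (Fin.castAdd 4 s) = C s :=
    (appendRows_castAdd D₁ _ (Fin.castAdd 2 s)).trans (appendRows_castAdd C _ s)
  have hDb (t : Fin 4) : D (Fin.natAdd k t) = Pi.single (b t) 1 := by
    fin_cases t
    · exact (appendRows_castAdd D₁ _ (Fin.natAdd k 0)).trans (appendRows_natAdd C _ 0)
    · exact (appendRows_castAdd D₁ _ (Fin.natAdd k 1)).trans (appendRows_natAdd C _ 1)
    · exact appendRows_natAdd D₁ _ 0
    · exact appendRows_natAdd D₁ _ 1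
  convert hD.det_mul_nonneg hZ using 1
  congr 1
  funext s
  induction s using Fin.addCases with
  | left s => ext l; simp [Matrix.mul_apply, hDC]
  | right t => ext l; simp [Matrix.mul_apply, hDb, Pi.single_apply]

theorem det_append_update_perm {k q : ℕ} (Y : Matrix (Fin k) (Fin (k + q)) ℝ) (r : Fin k)
    (w : Fin (q + 1) → Fin (k + q) → ℝ) (σ : Equiv.Perm (Fin (q + 1))) :
    Matrix.det (appendRows (Y.updateRow r (w (σ 0))) fun t => w (σ t.succ)) =
      ((Equiv.Perm.sign σ : ℤ) : ℝ) *
        Matrix.det (appendRows (Y.updateRow r (w 0)) fun t => w t.succ) := by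
  let pos : Fin (q + 1) → Fin (k + q) := Fin.cons (Fin.castAdd q r) (Fin.natAdd k)
  have hpos : Function.Injective pos := by
    rw [Fin.cons_injective_iff]
    refine ⟨?_, fun a b h => Fin.natAdd_injective _ _ h⟩
    rintro ⟨t, ht⟩
    have := congrArg Fin.val ht
    simp at this
    omega
  let ι : Fin (q + 1) ↪ Fin (k + q) := ⟨pos, hpos⟩
  have row (u : Fin (q + 1) → Fin (k + q) → ℝ) (x : Fin (q + 1)) :
      appendRows (Y.updateRow r (u 0)) (fun t => u t.succ) (ι x) = u x := by
    cases x using Fin.cases with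
    | zero => exact (appendRows_castAdd _ _ r).trans (by simp)
    | succ t => exact appendRows_natAdd _ _ t
  rw [← Equiv.Perm.viaFintypeEmbedding_sign σ ι, ← Matrix.det_permute]
  congr 1
  funext i
  change _ = appendRows (Y.updateRow r (w 0)) (fun t => w t.succ) (σ.viaFintypeEmbedding ι i)
  by_cases hi : i ∈ Set.range ι
  · obtain ⟨x, rfl⟩ := hi
    rw [Equiv.Perm.viaFintypeEmbedding_apply_image, row, row fun x => w (σ x)]
  · rw [Equiv.Perm.viaFintypeEmbedding_apply_notMem_range _ _ hi]
    induction i using Fin.addCases with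
    | left s =>
      have hs : s ≠ r := by
        rintro rfl
        exact hi ⟨0, rfl⟩
      simp [hs]
    | right t => exact absurd ⟨t.succ, rfl⟩ hi

/-- If a row of `Y` is a combination of `q + 1` vectors, the maximal minors of `Y` completed by all
but one of these vectors are, up to alternating sign, proportional to the coefficients. -/
theorem neg_one_pow_mul_det_append_succAbove {k q : ℕ} (Y : Matrix (Fin k) (Fin (k + q)) ℝ) (r : Fin k)
    (z : Fin (q + 1) → Fin (k + q) → ℝ) (c : Fin (q + 1) → ℝ) (hY : Y r = ∑ x, c x • z x)
    (h : Fin (q + 1)) :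
    (-1) ^ (h : ℕ) * Matrix.det (appendRows Y fun t => z (h.succAbove t)) =
      Matrix.det (appendRows (Y.updateRow r (z 0)) fun t => z t.succ) * c h := by
  let A : Matrix (Fin (k + q)) (Fin (k + q)) ℝ :=
    appendRows (Y.updateRow r (z h)) fun t => z (h.succAbove t)
  let d : Fin (k + q) → ℝ := Fin.append (Pi.single r (c h)) fun t => c (h.succAbove t)
  have hA : A.det = (-1) ^ (h : ℕ) *
      Matrix.det (appendRows (Y.updateRow r (z 0)) fun t => z t.succ) := by
    have := det_append_update_perm Y r z h.cycleRange.symm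
    simpa [Fin.cycleRange_symm_zero, Fin.cycleRange_symm_succ, Fin.sign_cycleRange] using this
  have hsum : ∑ i, d i • A i = Y r := by
    rw [Fin.sum_univ_add, hY, Fin.sum_univ_succAbove _ h, Finset.sum_eq_single r]
    · simp [d, A]
    · intro s _ hs
      simp [d, hs]
    · simp
  have hrow : A.updateRow (Fin.castAdd q r) (∑ i, d i • A i) =
      appendRows Y fun t => z (h.succAbove t) := by
    funext i
    rw [hsum]
    induction i using Fin.addCases with
    | left s =>
      by_cases hs : s = r
      · subst hs
        simp
      · rw [Matrix.updateRow_ne (by simpa using hs)]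
        simp [A, hs]
    | right t =>
      rw [Matrix.updateRow_ne (by simp [Fin.ext_iff]; omega)]
      simp [A]
  rw [← hrow, Matrix.det_updateRow_sum, hA]
  have hd : d (Fin.castAdd q r) = c h := by simp [d]
  rw [hd, smul_eq_mul, mul_left_comm, ← mul_assoc ((-1 : ℝ) ^ _), ← mul_pow]
  simp [mul_comm]

/-- Let `Z` be a positive `n × (k+4)` real matrix and `C` a totally
nonnegative `k × n` real matrix with a row `r` supported on the five consecutive
(1-based) markers `J = {m, m+1, m+2, m+3, m+4} ⊆ [n]`, all five entries positive.
Then there is `λ ≥ 0` such that for every `h = 0, …, 4` the alternating-sign twistor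
`(-1)^h · ⟨(CZ) (J ∖ {m+h})⟩` (the four remaining markers taken in increasing order)
equals `λ · C_r^{m+h}`. -/
theorem five_consecutive_support_twistors
    (k n : ℕ) (hk : 1 ≤ k) (hn : k + 4 ≤ n)
    (Z : Matrix (Fin n) (Fin (k + 4)) ℝ) (hZ : IsPositiveMatrix Z)
    (C : Matrix (Fin k) (Fin n) ℝ) (hC : IsTotallyNonnegRect C)
    (m : ℕ) (r : Fin k) (hm1 : 1 ≤ m) (hmn : m + 4 ≤ n)
    (hsupp : ∀ a : Fin n, ((a : ℕ) + 1 < m ∨ m + 4 < (a : ℕ) + 1) → C r a = 0)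
    (hpos : ∀ a : Fin n, m ≤ (a : ℕ) + 1 → (a : ℕ) + 1 ≤ m + 4 → 0 < C r a) :
    ∃ lam : ℝ, 0 ≤ lam ∧
      ∀ h : Fin 5, ∀ a : Fin n, (a : ℕ) + 1 = m + (h : ℕ) →
        (-1 : ℝ) ^ (h : ℕ) *
            twistor Z (C * Z) (fun t => m + ((h.succAbove t : Fin 5) : ℕ)) =
          lam * C r a := by
  let J : Fin 5 → Fin n := fun x => ⟨m - 1 + x, by omega⟩
  have hJ : Function.Injective J := fun x y hxy => by
    have := congrArg Fin.val hxy
    simp only [J] at this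
    omega
  have hmarker (x : Fin 5) : markerRow Z (m + (x : ℕ)) = Z (J x) := by
    have hx : m + (x : ℕ) - 1 = m - 1 + x := by omega
    have hlt : m - 1 + (x : ℕ) < n := by omega
    simp [markerRow, hx, hlt, J]
  have hrow : (C * Z) r = ∑ x, C r (J x) • Z (J x) := by
    have hfull : (C * Z) r = ∑ a, C r a • Z a := by
      ext l
      simp [Matrix.mul_apply, Finset.sum_apply]
    rw [hfull]
    refine (Fintype.sum_of_injective J hJ _ _ (fun a ha => ?_) fun _ => rfl).symm
    rw [hsupp a, zero_smul]
    by_contra hcon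
    refine ha ⟨⟨a + 1 - m, by omega⟩, Fin.ext ?_⟩
    simp only [J]
    omega
  have key := neg_one_pow_mul_det_append_succAbove (C * Z) r (fun x => Z (J x))
    (fun x => C r (J x)) hrow
  refine ⟨Matrix.det (appendRows ((C * Z).updateRow r (Z (J 0))) fun t => Z (J t.succ)),
    ?_, fun h a ha => ?_⟩
  swap
  · have haJ : a = J h := Fin.ext (by simp only [J]; omega)
    rw [twistor_eq_det_append, haJ]
    simp only [hmarker]
    exact key h
  · have h0 := key 0
    have hnonneg := det_append_consecutive_pairs_nonneg hZ hC (fun t => J t.succ) rfl rfl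
    have hc : 0 < C r (J 0) := hpos _ (by simp [J]; omega) (by simp [J]; omega)
    simp only [Fin.val_zero, pow_zero, one_mul, Fin.succAbove_zero] at h0
    exact nonneg_of_mul_nonneg_left (h0 ▸ hnonneg) hc

end
end

section
/- Let D ∈ CD_{n,k} be a chord diagram with a top chord c = (i, i+1, j, j+1), let A = {i, i+1, j, j+1, n}, and let C be a domino matrix of D satisfying the sign rules. Then: (1) det(C^I) = 0 for every k-element subset I ⊆ [n] with I ∩ A = ∅; (2) for every p ∈ A there exists a k-element subset I ⊆ [n] with I ∩ A = {p} such that det(C^I) ≠ 0 for every domino matrix C of D satisfying the sign rules; (3) the row space of C contains no nonzero vector supported on a proper subset of A. -/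
open scoped Classical

noncomputable section

/-- A chord diagram with `n` markers (labelled `1, …, n`) and `k` chords
`c_l = (tail l, tail l + 1, head l, head l + 1)`. -/
structure ChordDiagram (n k : ℕ) where
  tail : Fin k → ℕ
  head : Fin k → ℕ
  one_le_tail : ∀ l, 1 ≤ tail l
  tail_add_two_le_head : ∀ l, tail l + 2 ≤ head l
  head_add_two_le : ∀ l, head l + 2 ≤ n
  tail_strictMono : StrictMono tail
  noncrossing : ∀ l m : Fin k, l < m → ¬(tail m < head l ∧ head l < head m)

namespace ChordDiagram

variable {n k : ℕ} (D : ChordDiagram n k)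

/-- `c_m` is a descendant of `c_l`. -/
def Descendant (l m : Fin k) : Prop := D.tail l < D.tail m ∧ D.head m ≤ D.head l

/-- The number of descendants of `c_l`. -/
def below (l : Fin k) : ℕ := (Finset.univ.filter fun m => D.Descendant l m).card

/-- `c_l` is a top chord: it has no ancestor. -/
def IsTop (l : Fin k) : Prop := ∀ m, ¬ D.Descendant m l

/-- `c_m` is the parent of `c_l`: the ancestor of `c_l` with the largest start. -/
def IsParent (m l : Fin k) : Prop :=
  D.Descendant m l ∧ ∀ m', D.Descendant m' l → D.tail m' ≤ D.tail m

/-- The number of chords starting after the start of `c_l` (equals `k - l` for the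
`l`-th chord in the 1-based start-increasing ordering). -/
def behind (l : Fin k) : ℕ := (Finset.univ.filter fun m => D.tail l < D.tail m).card

/-- The number of descendants of `c_m` (the parent of `c_l`) that come before `c_l`
(equals `l - m - 1` in the 1-based start-increasing ordering). -/
def beyond (l m : Fin k) : ℕ :=
  (Finset.univ.filter fun h => D.Descendant m h ∧ D.tail h < D.tail l).card

/-- The domino matrix of `D` with variables `α, β, γ, δ, ε` : the column with (0-based)
index `a` corresponds to the (1-based) marker `a + 1`. -/
def dominoMatrix (α β γ δ ε : Fin k → ℝ) : Matrix (Fin k) (Fin n) ℝ :=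
  Matrix.of fun l a =>
    (if (a : ℕ) + 1 = D.tail l then α l else 0) +
    (if (a : ℕ) + 1 = D.tail l + 1 then β l else 0) +
    (if (a : ℕ) + 1 = D.head l then γ l else 0) +
    (if (a : ℕ) + 1 = D.head l + 1 then δ l else 0) +
    (if D.IsTop l ∧ (a : ℕ) + 1 = n then ε l else 0) +
    (∑ m : Fin k, if D.IsParent m l then
        (if (a : ℕ) + 1 = D.tail m then ε l * α m else 0) +
        (if (a : ℕ) + 1 = D.tail m + 1 then ε l * β m else 0)
      else 0)

/-- The sign rules for the domino variables of `D`. -/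
def SignRules (α β γ δ ε : Fin k → ℝ) : Prop :=
  (∀ l, 0 < α l) ∧ (∀ l, 0 < β l) ∧
  (∀ l, 0 < (-1 : ℝ) ^ D.below l * γ l) ∧
  (∀ l, 0 < (-1 : ℝ) ^ D.below l * δ l) ∧
  (∀ l, D.IsTop l → 0 < (-1 : ℝ) ^ D.behind l * ε l) ∧
  (∀ l m, D.IsParent m l → 0 < (-1 : ℝ) ^ D.beyond l m * ε l) ∧
  (∀ l m, D.IsParent m l → D.head l = D.head m → δ l / γ l < δ m / γ m) ∧
  (∀ l m, D.head m = D.tail l → δ m / γ m < β l / α l)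

end ChordDiagram


/-- A square matrix with nonzero diagonal whose off-diagonal nonzero entries strictly decrease
a natural-number rank has nonzero determinant. -/
theorem Matrix.det_ne_zero_of_rank_lt {ι : Type*} [Fintype ι] [DecidableEq ι]
    {M : Matrix ι ι ℝ} (r : ι → ℕ) (hdiag : ∀ x, M x x ≠ 0)
    (hlt : ∀ x y, x ≠ y → M x y ≠ 0 → r y < r x) : M.det ≠ 0 := by
  intro hdet
  obtain ⟨w, hw, hMw⟩ := Matrix.exists_mulVec_eq_zero_iff.2 hdet
  refine hw (funext fun x => ?_)
  induction hx : r x using Nat.strong_induction_on generalizing x with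
  | _ N ih =>
    have hrow : ∑ y, M x y * w y = 0 := congrFun hMw x
    rw [Finset.sum_eq_single x] at hrow
    · exact (mul_eq_zero.1 hrow).resolve_left (hdiag x)
    · intro y _ hyx
      by_cases hxy : M x y = 0
      · rw [hxy, zero_mul]
      · rw [ih (r y) (hx ▸ hlt x y hyx.symm hxy) y rfl, Pi.zero_apply, mul_zero]
    · simp

/-- If the columns of `C` picked by an injective `f` form an invertible matrix, then the minor
on the image of `f` is nonzero. -/
theorem colMinor_image_ne_zero {k n : ℕ} {C : Matrix (Fin k) (Fin n) ℝ} {f : Fin k → Fin n}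
    (hf : Function.Injective f) (hdet : (C.submatrix id f).det ≠ 0) :
    colMinor C (Finset.univ.image f) ≠ 0 := by
  have hcard : (Finset.univ.image f).card = k := by
    simp [Finset.card_image_of_injective _ hf]
  rw [colMinor, dif_pos hcard]
  intro h0
  obtain ⟨u, hu, huC⟩ := Matrix.exists_vecMul_eq_zero_iff.2 h0
  refine hdet (Matrix.exists_vecMul_eq_zero_iff.1 ⟨u, hu, funext fun y => ?_⟩)
  obtain ⟨t, ht⟩ := ((Finset.univ.image f).orderIsoOfFin hcard).surjective
    ⟨f y, Finset.mem_image_of_mem f (Finset.mem_univ y)⟩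
  have hcol : ∑ i, u i * C i ((Finset.univ.image f).orderIsoOfFin hcard t).1 = 0 :=
    congrFun huC t
  rw [ht] at hcol
  exact hcol

namespace ChordDiagram

variable {n k : ℕ} (D : ChordDiagram n k)

theorem eq_of_tail_eq {x y : Fin k} (h : D.tail x = D.tail y) : x = y :=
  D.tail_strictMono.injective h

theorem head_le_of_tail_lt {x y : Fin k} (h : D.tail x < D.tail y) (h' : D.tail y < D.head x) :
    D.head y ≤ D.head x :=
  not_lt.1 fun hlt => D.noncrossing x y (D.tail_strictMono.lt_iff_lt.1 h) ⟨h', hlt⟩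

/-- No chord starts one marker before the head of another chord. -/
theorem tail_add_one_ne_head (x y : Fin k) : D.tail y + 1 ≠ D.head x := by
  intro h
  have hx := D.tail_add_two_le_head x
  have hy := D.tail_add_two_le_head y
  have := D.head_le_of_tail_lt (x := x) (y := y) (by omega) (by omega)
  omega

variable {D} in
theorem IsTop.head_lt_head {x y : Fin k} (hy : D.IsTop y) (h : D.tail x < D.tail y) :
    D.head x < D.head y :=
  not_le.1 fun hle => hy x ⟨h, hle⟩

variable {D} in
theorem IsTop.head_le_tail {x y : Fin k} (hy : D.IsTop y) (h : D.tail x < D.tail y) :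
    D.head x ≤ D.tail y := by
  by_contra hlt
  have := D.head_le_of_tail_lt h (not_le.1 hlt)
  have := hy.head_lt_head h
  omega

variable {D} in
theorem IsTop.not_isParent {x m : Fin k} (hx : D.IsTop x) : ¬ D.IsParent m x :=
  fun h => hx m h.1

variable {D} in
/-- A chord starting at the head of a top chord is itself a top chord. -/
theorem IsTop.of_tail_eq_head {x y : Fin k} (hx : D.IsTop x) (h : D.tail y = D.head x) :
    D.IsTop y := by
  rintro p ⟨hp, hp'⟩
  have hy := D.tail_add_two_le_head y
  rcases lt_trichotomy (D.tail p) (D.tail x) with hlt | heq | hgt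
  · have := hx.head_lt_head hlt
    have := hx.head_le_tail hlt
    omega
  · rw [D.eq_of_tail_eq heq] at hp'
    omega
  · have := D.head_le_of_tail_lt hgt (by omega)
    omega

theorem dominoMatrix_ne_zero_cases {α β γ δ ε : Fin k → ℝ} {x : Fin k} {a : Fin n}
    (h : D.dominoMatrix α β γ δ ε x a ≠ 0) :
    (a : ℕ) + 1 = D.tail x ∨ (a : ℕ) + 1 = D.tail x + 1 ∨ (a : ℕ) + 1 = D.head x ∨
      (a : ℕ) + 1 = D.head x + 1 ∨ (D.IsTop x ∧ (a : ℕ) + 1 = n) ∨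
      ∃ m, D.IsParent m x ∧ ((a : ℕ) + 1 = D.tail m ∨ (a : ℕ) + 1 = D.tail m + 1) := by
  contrapose! h
  obtain ⟨h1, h2, h3, h4, h5, h6⟩ := h
  rw [dominoMatrix, Matrix.of_apply, if_neg h1, if_neg h2, if_neg h3, if_neg h4,
    if_neg fun h => h5 h.1 h.2, Finset.sum_eq_zero]
  · simp
  · intro m _
    split_ifs with hm h7 h8 h8
    · exact absurd h7 (h6 m hm).1
    · exact absurd h7 (h6 m hm).1
    · exact absurd h8 (h6 m hm).2
    · simp
    · rfl

/-- The row of a top chord is supported on its own markers and `n`. -/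
theorem mem_of_row_ne_zero {α β γ δ ε : Fin k → ℝ} {l : Fin k} (hl : D.IsTop l) {a : Fin n}
    (h : D.dominoMatrix α β γ δ ε l a ≠ 0) :
    (a : ℕ) + 1 ∈ ({D.tail l, D.tail l + 1, D.head l, D.head l + 1, n} : Finset ℕ) := by
  simp only [Finset.mem_insert, Finset.mem_singleton]
  rcases D.dominoMatrix_ne_zero_cases h with h | h | h | h | ⟨-, h⟩ | ⟨m, hm, -⟩
  · simp [h]
  · simp [h]
  · simp [h]
  · simp [h]
  · simp [h]
  · exact absurd hm hl.not_isParent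

theorem SignRules.ne_zero {α β γ δ ε : Fin k → ℝ} (hs : D.SignRules α β γ δ ε) (x : Fin k) :
    α x ≠ 0 ∧ β x ≠ 0 ∧ γ x ≠ 0 ∧ δ x ≠ 0 ∧ (D.IsTop x → ε x ≠ 0) := by
  obtain ⟨hα, hβ, hγ, hδ, hε, -⟩ := hs
  exact ⟨(hα x).ne', (hβ x).ne', right_ne_zero_of_mul (hγ x).ne',
    right_ne_zero_of_mul (hδ x).ne', fun hx => right_ne_zero_of_mul (hε x hx).ne'⟩

/-- The row of a top chord is nonzero at each of its markers and at `n`. -/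
theorem row_ne_zero_of_mem {α β γ δ ε : Fin k → ℝ} (hs : D.SignRules α β γ δ ε) {l : Fin k}
    (hl : D.IsTop l) {a : Fin n}
    (h : (a : ℕ) + 1 ∈ ({D.tail l, D.tail l + 1, D.head l, D.head l + 1, n} : Finset ℕ)) :
    D.dominoMatrix α β γ δ ε l a ≠ 0 := by
  obtain ⟨hα, hβ, hγ, hδ, hε⟩ := SignRules.ne_zero D hs l
  have hε := hε hl
  have h1 := D.tail_add_two_le_head l
  have h2 := D.head_add_two_le l
  have hpar : ∀ m, ¬ D.IsParent m l := fun m => hl.not_isParent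
  rw [dominoMatrix, Matrix.of_apply]
  simp only [hpar, if_false, Finset.sum_const_zero, hl, true_and, add_zero]
  simp only [Finset.mem_insert, Finset.mem_singleton] at h
  rcases h with h | h | h | h | h
  · rw [if_pos h, if_neg (by omega), if_neg (by omega), if_neg (by omega), if_neg (by omega)]
    simpa
  · rw [if_neg (by omega), if_pos h, if_neg (by omega), if_neg (by omega), if_neg (by omega)]
    simpa
  · rw [if_neg (by omega), if_neg (by omega), if_pos h, if_neg (by omega), if_neg (by omega)]
    simpa
  · rw [if_neg (by omega), if_neg (by omega), if_neg (by omega), if_pos h, if_neg (by omega)]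
    simpa
  · rw [if_neg (by omega), if_neg (by omega), if_neg (by omega), if_neg (by omega), if_pos h]
    simpa

theorem dominoMatrix_tail_add_one {α β γ δ ε : Fin k → ℝ} {x : Fin k} {a : Fin n}
    (h : (a : ℕ) + 1 = D.tail x + 1) : D.dominoMatrix α β γ δ ε x a = β x := by
  have h1 := D.tail_add_two_le_head x
  have h2 := D.head_add_two_le x
  rw [dominoMatrix, Matrix.of_apply, if_neg (by omega), if_pos h, if_neg (by omega),
    if_neg (by omega), if_neg (by omega), Finset.sum_eq_zero]
  · simp
  · intro m _
    split_ifs with hm h7 h8 h8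
    · omega
    · have := hm.1.1
      omega
    · have := hm.1.1
      omega
    · simp
    · rfl

/-- The marker of the column matched with the chord `x`, when the top chord `l` is matched
with the marker `p`: the head for top chords after `l`, the second tail marker otherwise. -/
def pivot (l : Fin k) (p : ℕ) (x : Fin k) : ℕ :=
  if x = l then p else if D.IsTop x ∧ D.tail l < D.tail x then D.head x else D.tail x + 1

/-- The rank ordering the chords so that the pivot columns are triangular. -/
def pivotRank (l x : Fin k) : ℕ :=
  if x = l then 0 else if D.IsTop x ∧ D.tail l < D.tail x then D.tail x
  else n + (n - D.head x) * (n + 1) + D.tail x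

theorem pivot_not_mem {l x : Fin k} (hl : D.IsTop l) (hx : x ≠ l) (p : ℕ) :
    D.pivot l p x ∉ ({D.tail l, D.tail l + 1, D.head l, D.head l + 1, n} : Finset ℕ) := by
  have hl1 := D.tail_add_two_le_head l
  have hx1 := D.tail_add_two_le_head x
  have hx2 := D.head_add_two_le x
  simp only [Finset.mem_insert, Finset.mem_singleton, pivot, if_neg hx]
  split_ifs with hR
  · have := hR.1.head_le_tail hR.2
    omega
  · have hne := D.tail_add_one_ne_head l x
    have htail : D.tail x ≠ D.tail l := fun h => hx (D.eq_of_tail_eq h)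
    rintro (h | h | h | h | h)
    · have := hl.head_le_tail (x := x) (by omega)
      omega
    · omega
    · omega
    · exact hR ⟨hl.of_tail_eq_head (by omega), by omega⟩
    · omega

/-- Nonzero entries in the pivot columns strictly decrease the rank off the diagonal. -/
theorem pivotRank_lt {α β γ δ ε : Fin k → ℝ} {l : Fin k} (hl : D.IsTop l) {p : ℕ}
    {x y : Fin k} (hxy : x ≠ y) {a : Fin n} (ha : (a : ℕ) + 1 = D.pivot l p y)
    (h : D.dominoMatrix α β γ δ ε x a ≠ 0) : D.pivotRank l y < D.pivotRank l x := by
  have hx0 := D.one_le_tail x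
  have hx1 := D.tail_add_two_le_head x
  have hx2 := D.head_add_two_le x
  have hy1 := D.tail_add_two_le_head y
  have hy2 := D.head_add_two_le y
  by_cases hxl : x = l
  · subst hxl
    exact absurd (ha ▸ D.mem_of_row_ne_zero hl h) (D.pivot_not_mem hl hxy.symm p)
  by_cases hyl : y = l
  · simp only [pivotRank, if_pos hyl, if_neg hxl]
    split_ifs <;> omega
  have htail : D.tail x ≠ D.tail y := fun h => hxy (D.eq_of_tail_eq h)
  have hne := D.tail_add_one_ne_head x y
  have hne' := D.tail_add_one_ne_head y x
  have hcases := D.dominoMatrix_ne_zero_cases h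
  rw [ha] at hcases
  simp only [pivot, if_neg hyl] at hcases
  simp only [pivotRank, if_neg hxl, if_neg hyl]
  by_cases hxR : D.IsTop x ∧ D.tail l < D.tail x
  · rw [if_pos hxR]
    by_cases hyR : D.IsTop y ∧ D.tail l < D.tail y
    · rw [if_pos hyR] at hcases ⊢
      rcases lt_or_gt_of_ne htail with hlt | hgt
      · have := hyR.1.head_le_tail hlt
        rcases hcases with h | h | h | h | ⟨-, h⟩ | ⟨m, hm, -⟩
        iterate 5 omega
        exact absurd hm hxR.1.not_isParent
      · exact hgt
    · rw [if_neg hyR] at hcases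
      exfalso
      rcases hcases with h | h | h | h | ⟨-, h⟩ | ⟨m, hm, -⟩
      · have := hxR.1.head_le_tail (x := y) (by omega)
        omega
      · omega
      · omega
      · exact hyR ⟨hxR.1.of_tail_eq_head (by omega), by omega⟩
      · omega
      · exact hxR.1.not_isParent hm
  · rw [if_neg hxR]
    by_cases hyR : D.IsTop y ∧ D.tail l < D.tail y
    · rw [if_pos hyR]
      omega
    · rw [if_neg hyR] at hcases ⊢
      have hkey : D.head x < D.head y ∨ D.head x ≤ D.head y ∧ D.tail y < D.tail x := by
        rcases hcases with h | h | h | h | ⟨-, h⟩ | ⟨m, hm, h⟩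
        · exact Or.inr ⟨D.head_le_of_tail_lt (by omega) (by omega), by omega⟩
        · omega
        · omega
        · omega
        · omega
        · obtain ⟨⟨hm1, hm2⟩, -⟩ := hm
          rcases h with h | h
          · have := D.head_le_of_tail_lt (x := y) (y := m) (by omega) (by omega)
            omega
          · rw [D.eq_of_tail_eq (x := y) (y := m) (by omega)]
            exact Or.inr ⟨hm2, hm1⟩
      rcases hkey with hlt | ⟨hle, hlt⟩
      · have : (n - D.head y + 1) * (n + 1) ≤ (n - D.head x) * (n + 1) :=
          Nat.mul_le_mul_right _ (by omega)
        rw [add_mul, one_mul] at this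
        omega
      · have : (n - D.head y) * (n + 1) ≤ (n - D.head x) * (n + 1) :=
          Nat.mul_le_mul_right _ (by omega)
        omega

/-- For a marker `p` of a top chord `l` (or `p = n`), there are columns, one of them `p` and the
others avoiding the markers of `l` and `n`, on which every domino matrix satisfying the sign
rules is invertible. -/
theorem exists_columns_det_ne_zero {l : Fin k} (hl : D.IsTop l) {p : ℕ}
    (hp : p ∈ ({D.tail l, D.tail l + 1, D.head l, D.head l + 1, n} : Finset ℕ)) :
    ∃ f : Fin k → Fin n, (f l : ℕ) + 1 = p ∧
      (∀ x, x ≠ l → (f x : ℕ) + 1 ∉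
        ({D.tail l, D.tail l + 1, D.head l, D.head l + 1, n} : Finset ℕ)) ∧
      ∀ α β γ δ ε : Fin k → ℝ, D.SignRules α β γ δ ε →
        ((D.dominoMatrix α β γ δ ε).submatrix id f).det ≠ 0 := by
  have hex : ∀ x, ∃ a : Fin n, (a : ℕ) + 1 = D.pivot l p x := by
    intro x
    have hl0 := D.one_le_tail l
    have hl1 := D.tail_add_two_le_head l
    have hl2 := D.head_add_two_le l
    have hx1 := D.tail_add_two_le_head x
    have hx2 := D.head_add_two_le x
    simp only [Finset.mem_insert, Finset.mem_singleton] at hp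
    have hbd : 1 ≤ D.pivot l p x ∧ D.pivot l p x ≤ n := by
      unfold pivot
      split_ifs <;> omega
    exact ⟨⟨D.pivot l p x - 1, by omega⟩, Nat.sub_add_cancel hbd.1⟩
  choose f hf using hex
  have hfl : (f l : ℕ) + 1 = p := by rw [hf, pivot, if_pos rfl]
  refine ⟨f, hfl, fun x hx => hf x ▸ D.pivot_not_mem hl hx p, fun α β γ δ ε hs => ?_⟩
  refine Matrix.det_ne_zero_of_rank_lt (D.pivotRank l) (fun x => ?_)
    fun x y hxy h => D.pivotRank_lt hl hxy (hf y) h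
  rw [Matrix.submatrix_apply, id]
  have hfx := hf x
  by_cases hx : x = l
  · subst hx
    exact D.row_ne_zero_of_mem hs hl (hfl ▸ hp)
  · rw [pivot, if_neg hx] at hfx
    split_ifs at hfx with hR
    · exact D.row_ne_zero_of_mem hs hR.1 (by simp [hfx])
    · rw [D.dominoMatrix_tail_add_one hfx]
      exact (hs.2.1 x).ne'

end ChordDiagram

/-- Let `D` be a chord diagram with a top chord
`c_l = (i, i+1, j, j+1)`, let `A = {i, i+1, j, j+1, n}` (1-based markers), and let `C` be
a domino matrix of `D` satisfying the sign rules.  Then: (1) every `k × k` minor of `C`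
on a column set whose markers avoid `A` vanishes; (2) for every `p ∈ A` there is a
`k`-element column set whose markers meet `A` exactly in `{p}`, on which the minor of
every domino matrix of `D` satisfying the sign rules is nonzero; (3) the row space of `C`
contains no nonzero vector supported on a proper subset of `A`. -/
theorem top_chord_minor_lemma
    (n k : ℕ) (hk : 1 ≤ k) (hn : k + 4 ≤ n)
    (D : ChordDiagram n k) (l : Fin k) (hl : D.IsTop l)
    (α β γ δ ε : Fin k → ℝ) (hs : D.SignRules α β γ δ ε) :
    (∀ I : Finset (Fin n), I.card = k →
        (∀ a ∈ I, (a : ℕ) + 1 ∉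
          ({D.tail l, D.tail l + 1, D.head l, D.head l + 1, n} : Finset ℕ)) →
        colMinor (D.dominoMatrix α β γ δ ε) I = 0) ∧
    (∀ p ∈ ({D.tail l, D.tail l + 1, D.head l, D.head l + 1, n} : Finset ℕ),
        ∃ I : Finset (Fin n), I.card = k ∧
          I.image (fun a => (a : ℕ) + 1) ∩
              ({D.tail l, D.tail l + 1, D.head l, D.head l + 1, n} : Finset ℕ) = {p} ∧
          ∀ α' β' γ' δ' ε' : Fin k → ℝ, D.SignRules α' β' γ' δ' ε' →
            colMinor (D.dominoMatrix α' β' γ' δ' ε') I ≠ 0) ∧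
    (∀ v ∈ rowSpace (D.dominoMatrix α β γ δ ε),
        ∀ B : Finset ℕ,
          B ⊂ ({D.tail l, D.tail l + 1, D.head l, D.head l + 1, n} : Finset ℕ) →
          (∀ a : Fin n, v a ≠ 0 → (a : ℕ) + 1 ∈ B) → v = 0) := by
  have hdet : ∀ p ∈ ({D.tail l, D.tail l + 1, D.head l, D.head l + 1, n} :
      Finset ℕ), ∃ f : Fin k → Fin n, (f l : ℕ) + 1 = p ∧
        (∀ x, x ≠ l → (f x : ℕ) + 1 ∉
          ({D.tail l, D.tail l + 1, D.head l, D.head l + 1, n} : Finset ℕ)) ∧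
        ∀ α' β' γ' δ' ε' : Fin k → ℝ, D.SignRules α' β' γ' δ' ε' →
          ((D.dominoMatrix α' β' γ' δ' ε').submatrix id f).det ≠ 0 :=
    fun p hp => D.exists_columns_det_ne_zero hl hp
  refine ⟨fun I hI hIA => ?_, fun p hp => ?_, ?_⟩
  · rw [colMinor, dif_pos hI]
    refine Matrix.det_eq_zero_of_row_eq_zero l fun t => ?_
    by_contra hne
    exact hIA _ (I.orderIsoOfFin hI t).2 (D.mem_of_row_ne_zero hl hne)
  · obtain ⟨f, hfl, hfA, hf⟩ := hdet p hp
    have hinj : Function.Injective f := fun x y hxy => by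
      by_contra hne
      exact hf α β γ δ ε hs (Matrix.det_zero_of_column_eq hne fun i => by simp [hxy])
    refine ⟨Finset.univ.image f, by simp [Finset.card_image_of_injective _ hinj], ?_, ?_⟩
    · ext q
      simp only [Finset.mem_inter, Finset.mem_singleton, Finset.bind_def, Finset.pure_def,
        Finset.mem_image, Finset.mem_sup, Finset.mem_univ, true_and, exists_exists_eq_and]
      constructor
      · rintro ⟨⟨_, ⟨x, hx⟩, rfl⟩, hqA⟩
        rw [hx] at hqA ⊢
        by_cases hx : x = l
        · rw [hx, hfl]
        · exact absurd hqA (hfA x hx)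
      · rintro rfl
        exact ⟨⟨_, ⟨l, rfl⟩, hfl⟩, hp⟩
    · intro α' β' γ' δ' ε' hs'
      exact colMinor_image_ne_zero hinj (hf _ _ _ _ _ hs')
  · intro v hv B hB hvB
    obtain ⟨p, hp, hpB⟩ := Finset.exists_of_ssubset hB
    obtain ⟨f, hfl, hfA, hf⟩ := hdet p hp
    obtain ⟨u, rfl⟩ : ∃ u, Matrix.vecMul u (D.dominoMatrix α β γ δ ε) = v := by
      have := (Submodule.mem_span_range_iff_exists_fun ℝ).1 hv
      obtain ⟨u, hu⟩ := this
      exact ⟨u, by rw [Matrix.vecMul_eq_sum]; exact hu⟩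
    have hu : u = 0 := by
      by_contra hne
      refine hf α β γ δ ε hs (Matrix.exists_vecMul_eq_zero_iff.1 ⟨u, hne, ?_⟩)
      ext y
      by_contra hy
      have hmem := hvB (f y) hy
      by_cases hyl : y = l
      · rw [hyl, hfl] at hmem
        exact hpB hmem
      · exact hfA y hyl (hB.subset hmem)
    rw [hu, Matrix.zero_vecMul]

end
end
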